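/- arXiv:2209.04323 — 2 statements merged into one kernel-verified Lean document; each statement's English description precedes it below -/
import Mathlib

section
/- Let α ∈ ℝ, 0 < p ≤ ∞, and let X be a ball Banach function space on ℝⁿ for which there exist δ_X ∈ (0,1) and C > 0 with ‖χ_E‖_X/‖χ_B‖_X ≤ C(|E|/|B|)^{δ_X} for all balls B and measurable E ⊆ B. If α + nδ_X > 0, then for every l ∈ ℤ the characteristic function χ_{B(0,2^l)} of the ball B(0,2^l) satisfies ‖χ_{B(0,2^l)}‖_{K̇^{α,p}_X} < ∞; consequently K̇^{α,p}_X(ℝⁿ) contains the characteristic function of every ball. -/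
open MeasureTheory ENNReal Set Filter
open scoped NNReal Topology

noncomputable section

/-- Euclidean space `ℝⁿ`. -/
abbrev Euc (n : ℕ) := EuclideanSpace ℝ (Fin n)

/-- The dyadic annulus `C_k = B(0,2^k) \ B(0,2^{k-1})`. -/
def annulus (n : ℕ) (k : ℤ) : Set (Euc n) :=
  Metric.ball (0 : Euc n) ((2 : ℝ) ^ k) \ Metric.ball (0 : Euc n) ((2 : ℝ) ^ (k - 1))

/-- The Hardy–Littlewood maximal operator, acting on nonnegative extended-real-valued
functions (representing `|f|`): `Mf(x) = sup_{B ∋ x} |B|⁻¹ ∫_B f`. -/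
def maximalFn {n : ℕ} (f : Euc n → ℝ≥0∞) (x : Euc n) : ℝ≥0∞ :=
  ⨆ (c : Euc n) (r : ℝ) (_ : 0 < r) (_ : x ∈ Metric.ball c r),
    (volume (Metric.ball c r))⁻¹ * ∫⁻ y in Metric.ball c r, f y ∂volume

/-- A ball Banach function space on `ℝⁿ`, encoded by its norm functional `N`,
defined on all nonnegative extended-real-valued measurable functions (a real measurable
function `f` has norm `N (fun x => ‖f x‖₊)`). -/
structure BallBFS (n : ℕ) where
  N : (Euc n → ℝ≥0∞) → ℝ≥0∞
  norm_zero_iff : ∀ f : Euc n → ℝ≥0∞, Measurable f → (N f = 0 ↔ f =ᵐ[volume] 0)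
  norm_mono : ∀ f g : Euc n → ℝ≥0∞, (∀ᵐ x ∂volume, g x ≤ f x) → N g ≤ N f
  norm_isup : ∀ f : ℕ → Euc n → ℝ≥0∞, (∀ m, ∀ᵐ x ∂volume, f m x ≤ f (m + 1) x) →
    N (fun x => ⨆ m, f m x) = ⨆ m, N (f m)
  ball_mem : ∀ (x : Euc n) (r : ℝ), 0 < r → N ((Metric.ball x r).indicator 1) < ∞
  norm_add : ∀ f g : Euc n → ℝ≥0∞, N (fun x => f x + g x) ≤ N f + N g
  ball_integral : ∀ (x : Euc n) (r : ℝ), 0 < r → ∃ C : ℝ≥0∞, 0 < C ∧ C < ∞ ∧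
    ∀ f : Euc n → ℝ≥0∞, N f < ∞ → ∫⁻ y in Metric.ball x r, f y ∂volume ≤ C * N f

/-- The associate ("Köthe dual") norm of a norm functional `N`:
`‖g‖_{X'} = sup { ∫ f·g : ‖f‖_X ≤ 1 }`. -/
def assocN {n : ℕ} (N : (Euc n → ℝ≥0∞) → ℝ≥0∞) (g : Euc n → ℝ≥0∞) : ℝ≥0∞ :=
  ⨆ (f : Euc n → ℝ≥0∞) (_ : Measurable f) (_ : N f ≤ 1), ∫⁻ x, f x * g x ∂volume

/-- The homogeneous Herz-type quasinorm associated with a norm functional `N`,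
for a finite exponent `0 < p < ∞`:
`‖f‖ = (Σ_{k∈ℤ} 2^{kpα} ‖f χ_k‖_X ^ p)^{1/p}`. -/
def herzNorm {n : ℕ} (N : (Euc n → ℝ≥0∞) → ℝ≥0∞) (α p : ℝ) (f : Euc n → ℝ≥0∞) : ℝ≥0∞ :=
  (∑' k : ℤ, (2 : ℝ≥0∞) ^ ((k : ℝ) * p * α) * (N ((annulus n k).indicator f)) ^ p) ^ (1 / p)

/-- The homogeneous Herz-type quasinorm, with exponent `p ∈ (0,∞]`
(for `p = ∞` the sum is replaced by a supremum). -/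
def herzNormE {n : ℕ} (N : (Euc n → ℝ≥0∞) → ℝ≥0∞) (α : ℝ) (p : ℝ≥0∞)
    (f : Euc n → ℝ≥0∞) : ℝ≥0∞ :=
  if p = ∞ then ⨆ k : ℤ, (2 : ℝ≥0∞) ^ ((k : ℝ) * α) * N ((annulus n k).indicator f)
  else herzNorm N α p.toReal f

theorem volume_ball_two_zpow_div {n : ℕ} (k l : ℤ) :
    volume (Metric.ball (0 : Euc n) ((2 : ℝ) ^ k)) / volume (Metric.ball (0 : Euc n) ((2 : ℝ) ^ l))
      = (2 : ℝ≥0∞) ^ (((k : ℝ) - l) * n) := by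
  have h2 : ∀ m : ℤ, ENNReal.ofReal (((2 : ℝ) ^ m) ^ n) = (2 : ℝ≥0∞) ^ ((m : ℝ) * n) := by
    intro m
    rw [← Real.rpow_intCast, ← Real.rpow_natCast, ← Real.rpow_mul (by norm_num),
      ← ENNReal.ofReal_rpow_of_pos (by norm_num)]
    norm_num
  have hball : ∀ m : ℤ, volume (Metric.ball (0 : Euc n) ((2 : ℝ) ^ m))
      = (2 : ℝ≥0∞) ^ ((m : ℝ) * n) * volume (Metric.ball (0 : Euc n) 1) := by
    intro m
    rw [Measure.addHaar_ball_of_pos volume (0 : Euc n) (show (0 : ℝ) < 2 ^ m by positivity), finrank_euclideanSpace_fin, h2]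
  have hpos : volume (Metric.ball (0 : Euc n) 1) ≠ 0 := (Metric.measure_ball_pos _ _ one_pos).ne'
  rw [hball, hball, ENNReal.mul_div_mul_right _ _ hpos measure_ball_lt_top.ne, sub_mul,
    ENNReal.rpow_sub _ _ two_ne_zero ofNat_ne_top]

namespace BallBFS

variable {n : ℕ} (X : BallBFS n)

theorem N_mono {f g : Euc n → ℝ≥0∞} (h : g ≤ f) : X.N g ≤ X.N f :=
  X.norm_mono f g (Eventually.of_forall h)

theorem N_zero : X.N 0 = 0 :=
  (X.norm_zero_iff 0 measurable_zero).2 (ae_eq_refl _)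

theorem N_indicator_ball_ne_zero (x : Euc n) {r : ℝ} (hr : 0 < r) :
    X.N ((Metric.ball x r).indicator 1) ≠ 0 := by
  rw [Ne, X.norm_zero_iff _ (measurable_one.indicator measurableSet_ball),
    indicator_ae_eq_zero]
  simpa using (Metric.measure_ball_pos volume x hr).ne'

theorem herzNormE_mono {f g : Euc n → ℝ≥0∞} (h : g ≤ f) (α : ℝ) (p : ℝ≥0∞) :
    herzNormE X.N α p g ≤ herzNormE X.N α p f := by
  have hN : ∀ k, X.N ((annulus n k).indicator g) ≤ X.N ((annulus n k).indicator f) :=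
    fun k => X.N_mono (indicator_mono h)
  unfold herzNormE
  split_ifs
  · exact iSup_mono fun k => by gcongr; exact hN k
  · exact ENNReal.rpow_le_rpow (ENNReal.tsum_le_tsum fun k => by gcongr; exact hN k)
      (by positivity)

/-- The Herz quasinorm is finite if the annular pieces vanish beyond `l` and decay
geometrically, fast enough to beat the weight, towards the origin. -/
theorem herzNormE_lt_top_of_decay {α γ : ℝ} {p : ℝ≥0∞} (hp : 0 < p) (hαγ : 0 < α + γ)
    {f : Euc n → ℝ≥0∞} {K : ℝ≥0∞} (hK : K ≠ ∞) {l : ℤ}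
    (hle : ∀ k ≤ l, X.N ((annulus n k).indicator f) ≤ K * (2 : ℝ≥0∞) ^ ((k : ℝ) * γ))
    (hzero : ∀ k, l < k → X.N ((annulus n k).indicator f) = 0) :
    herzNormE X.N α p f < ∞ := by
  unfold herzNormE
  split_ifs with hpt
  · have hfin : K * (2 : ℝ≥0∞) ^ ((l : ℝ) * (α + γ)) < ∞ :=
      ENNReal.mul_lt_top hK.lt_top
        (ENNReal.rpow_ne_top_of_ne_zero two_ne_zero ofNat_ne_top).lt_top
    refine (iSup_le fun k => ?_).trans_lt hfin
    rcases le_or_gt k l with hk | hk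
    · calc (2 : ℝ≥0∞) ^ ((k : ℝ) * α) * X.N ((annulus n k).indicator f)
          ≤ (2 : ℝ≥0∞) ^ ((k : ℝ) * α) * (K * (2 : ℝ≥0∞) ^ ((k : ℝ) * γ)) := by
            gcongr; exact hle k hk
        _ = K * (2 : ℝ≥0∞) ^ ((k : ℝ) * (α + γ)) := by
            rw [mul_add, ENNReal.rpow_add _ _ two_ne_zero ofNat_ne_top]; ring
        _ ≤ K * (2 : ℝ≥0∞) ^ ((l : ℝ) * (α + γ)) := by
            gcongr
            exact one_le_two
    · simp [hzero k hk]
  · have hq : 0 < p.toReal := ENNReal.toReal_pos hp.ne' hpt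
    set q := p.toReal
    refine ENNReal.rpow_lt_top_of_nonneg (by positivity) (ne_of_lt ?_)
    have hinj : Function.Injective fun j : ℕ => l - (j : ℤ) := fun a b h => by
      simpa using h
    rw [← hinj.tsum_eq]
    · have hbound : ∀ j : ℕ, (2 : ℝ≥0∞) ^ (((l - (j : ℤ) : ℤ) : ℝ) * q * α) *
          X.N ((annulus n (l - (j : ℤ))).indicator f) ^ q ≤
          (K ^ q * (2 : ℝ≥0∞) ^ ((l : ℝ) * q * (α + γ))) *
            ((2 : ℝ≥0∞) ^ (-(q * (α + γ)))) ^ j := by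
        intro j
        calc _ ≤ (2 : ℝ≥0∞) ^ (((l - (j : ℤ) : ℤ) : ℝ) * q * α) *
              (K * (2 : ℝ≥0∞) ^ (((l - (j : ℤ) : ℤ) : ℝ) * γ)) ^ q := by
              gcongr; exact hle _ (by omega)
          _ = _ := by
              rw [ENNReal.mul_rpow_of_nonneg _ _ hq.le, ← ENNReal.rpow_mul, mul_left_comm,
                ← ENNReal.rpow_add _ _ two_ne_zero ofNat_ne_top, ← ENNReal.rpow_natCast,
                ← ENNReal.rpow_mul, mul_assoc (K ^ q),
                ← ENNReal.rpow_add _ _ two_ne_zero ofNat_ne_top]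
              push_cast
              ring_nf
      refine (ENNReal.tsum_le_tsum hbound).trans_lt ?_
      rw [ENNReal.tsum_mul_left, ENNReal.tsum_geometric]
      refine ENNReal.mul_lt_top (ENNReal.mul_lt_top
        (ENNReal.rpow_lt_top_of_nonneg hq.le hK)
        (ENNReal.rpow_ne_top_of_ne_zero two_ne_zero ofNat_ne_top).lt_top) ?_
      rw [ENNReal.inv_lt_top, tsub_pos_iff_lt]
      exact ENNReal.rpow_lt_one_of_one_lt_of_neg one_lt_two (by nlinarith [mul_pos hq hαγ])
    · intro k hk
      by_contra hmem
      refine hk ?_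
      have hlk : l < k := by
        by_contra! hkl
        exact hmem ⟨(l - k).toNat, by simp only; omega⟩
      simp [hzero k hlk, hq]

end BallBFS

/-- Let `X` be a ball Banach function space admitting constants
`δ_X ∈ (0,1)`, `C > 0` with `‖χ_E‖_X/‖χ_B‖_X ≤ C(|E|/|B|)^{δ_X}` for all balls `B` and
measurable `E ⊆ B`. If `α + nδ_X > 0` then for every `l ∈ ℤ` the characteristic function of
`B(0,2^l)` has finite `K̇^{α,p}_X`-quasinorm (`0 < p ≤ ∞`); consequently `K̇^{α,p}_X(ℝⁿ)`
contains the characteristic function of every ball. -/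
theorem stmt2 {n : ℕ} (hn : 0 < n) (α : ℝ) (p : ℝ≥0∞) (hp : 0 < p) (X : BallBFS n)
    (δ : ℝ) (hδ : 0 < δ ∧ δ < 1) (C : ℝ≥0∞) (hC : 0 < C ∧ C < ∞)
    (hdy : ∀ (x : Euc n) (r : ℝ), 0 < r → ∀ E : Set (Euc n), MeasurableSet E →
      E ⊆ Metric.ball x r →
        X.N (E.indicator 1) / X.N ((Metric.ball x r).indicator 1)
          ≤ C * (volume E / volume (Metric.ball x r)) ^ δ)
    (hα : 0 < α + (n : ℝ) * δ) :
    (∀ l : ℤ, herzNormE X.N α p ((Metric.ball (0 : Euc n) ((2 : ℝ) ^ l)).indicator 1) < ∞) ∧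
    (∀ (x : Euc n) (r : ℝ), 0 < r →
      herzNormE X.N α p ((Metric.ball x r).indicator 1) < ∞) := by
  have main : ∀ l : ℤ,
      herzNormE X.N α p ((Metric.ball (0 : Euc n) ((2 : ℝ) ^ l)).indicator 1) < ∞ := by
    intro l
    have hl : (0 : ℝ) < 2 ^ l := by positivity
    set NB := X.N ((Metric.ball (0 : Euc n) ((2 : ℝ) ^ l)).indicator 1)
    have hNB0 : NB ≠ 0 := X.N_indicator_ball_ne_zero 0 hl
    have hNBt : NB ≠ ∞ := (X.ball_mem 0 _ hl).ne
    have hK : C * (2 : ℝ≥0∞) ^ (-((l : ℝ) * (n * δ))) * NB ≠ ∞ :=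
      ENNReal.mul_ne_top (ENNReal.mul_ne_top hC.2.ne
        (ENNReal.rpow_ne_top_of_ne_zero two_ne_zero ofNat_ne_top)) hNBt
    refine X.herzNormE_lt_top_of_decay hp hα hK (l := l) (fun k hk => ?_) (fun k hk => ?_)
    · have hsub : Metric.ball (0 : Euc n) ((2 : ℝ) ^ k) ⊆ Metric.ball 0 ((2 : ℝ) ^ l) :=
        Metric.ball_subset_ball (zpow_le_zpow_right₀ one_le_two hk)
      have hdiv := hdy 0 _ hl _ measurableSet_ball hsub
      rw [ENNReal.div_le_iff hNB0 hNBt, volume_ball_two_zpow_div, ← ENNReal.rpow_mul] at hdiv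
      calc X.N ((annulus n k).indicator ((Metric.ball (0 : Euc n) ((2 : ℝ) ^ l)).indicator 1))
          ≤ X.N ((Metric.ball (0 : Euc n) ((2 : ℝ) ^ k)).indicator 1) := by
            refine X.N_mono ?_
            rw [indicator_indicator]
            exact indicator_le_indicator_of_subset (fun x hx => hx.1.1) (fun _ => zero_le)
        _ ≤ _ := hdiv
        _ = _ := by
            rw [mul_right_comm _ NB, mul_assoc C ((2 : ℝ≥0∞) ^ _) ((2 : ℝ≥0∞) ^ _),
              ← ENNReal.rpow_add _ _ two_ne_zero ofNat_ne_top]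
            ring_nf
    · have hdisj : annulus n k ∩ Metric.ball (0 : Euc n) ((2 : ℝ) ^ l) = ∅ := by
        refine eq_empty_of_forall_notMem fun x hx => hx.1.2 ?_
        exact Metric.ball_subset_ball (zpow_le_zpow_right₀ one_le_two (by omega)) hx.2
      rw [indicator_indicator, hdisj, indicator_empty]
      exact X.N_zero
  refine ⟨main, fun x r _ => ?_⟩
  obtain ⟨m, hm⟩ := pow_unbounded_of_one_lt (r + ‖x‖) (one_lt_two (α := ℝ))
  refine (X.herzNormE_mono ?_ α p).trans_lt (main m)
  refine indicator_le_indicator_of_subset (Metric.ball_subset_ball' ?_) (fun _ => zero_le)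
  simpa using hm.le
end
end

section
/- Let α ∈ ℝ, 0 < p < ∞, and let q(·) : ℝⁿ → (0,∞) be globally log-Hölder continuous with 1 < q₋ ≤ q₊ < ∞. Let δ_{q(·)}, δ_{q'(·)} ∈ (0,1) be constants satisfying the dyadic estimate ‖χ_E‖_Y/‖χ_B‖_Y ≤ C(|E|/|B|)^{δ_Y} (for all balls B and measurable E ⊆ B) for Y = L^{q(·)}(ℝⁿ) and Y = L^{q'(·)}(ℝⁿ) respectively. If −nδ_{q(·)} < α < nδ_{q'(·)}, then the Hardy–Littlewood maximal operator M is bounded on the variable-exponent Herz space K̇^{α,p}_{q(·)}(ℝⁿ): there is C' > 0 such that every f with ‖f‖_{K̇^{α,p}_{q(·)}} < ∞ is locally integrable and ‖Mf‖_{K̇^{α,p}_{q(·)}} ≤ C'‖f‖_{K̇^{α,p}_{q(·)}}. -/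
open MeasureTheory ENNReal Set Filter
open scoped NNReal Topology

noncomputable section

/-- The variable-exponent Lebesgue quasinorm
`‖f‖_{L^{q(·)}} = inf {λ > 0 : ∫ (|f(x)|/λ)^{q(x)} dx ≤ 1}` (equal to `∞` if no such `λ`
exists), applied to nonnegative extended-real-valued `f` (representing `|f|`). -/
def varNorm {n : ℕ} (q : Euc n → ℝ) (f : Euc n → ℝ≥0∞) : ℝ≥0∞ :=
  ⨅ (lam : ℝ≥0∞) (_ : 0 < lam) (_ : lam ≠ ∞)
    (_ : ∫⁻ x, (f x / lam) ^ q x ∂volume ≤ 1), lam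

/-- `q(·)` is globally log-Hölder continuous. -/
def LogHolder {n : ℕ} (q : Euc n → ℝ) : Prop :=
  ∃ C : ℝ, 0 < C ∧ ∃ qinf : ℝ,
    (∀ x y : Euc n, x ≠ y →
      |q x - q y| ≤ C / Real.log (Real.exp 1 + 1 / dist x y)) ∧
    (∀ x : Euc n, |q x - qinf| ≤ C / Real.log (Real.exp 1 + ‖x‖))

/-- The Herz quasinorm of a real-valued function (finite exponent `p`). -/
def herzR {n : ℕ} (N : (Euc n → ℝ≥0∞) → ℝ≥0∞) (α p : ℝ) (f : Euc n → ℝ) : ℝ≥0∞ :=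
  herzNorm N α p (fun x => (‖f x‖₊ : ℝ≥0∞))

section

variable {n : ℕ}

lemma average_le_maximalFn (f : Euc n → ℝ≥0∞) {c x : Euc n} {r : ℝ} (hr : 0 < r)
    (hx : x ∈ Metric.ball c r) :
    (volume (Metric.ball c r))⁻¹ * ∫⁻ y in Metric.ball c r, f y ≤ maximalFn f x :=
  le_iSup₂_of_le c r (le_iSup₂_of_le hr hx le_rfl)

lemma maximalFn_le {f : Euc n → ℝ≥0∞} {x : Euc n} {a : ℝ≥0∞}
    (h : ∀ (c : Euc n) (r : ℝ), 0 < r → x ∈ Metric.ball c r →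
      (volume (Metric.ball c r))⁻¹ * ∫⁻ y in Metric.ball c r, f y ≤ a) :
    maximalFn f x ≤ a :=
  iSup₂_le fun c r => iSup₂_le fun hr hx => h c r hr hx

lemma maximalFn_mono_ae {f g : Euc n → ℝ≥0∞} (h : f ≤ᵐ[volume] g) (x : Euc n) :
    maximalFn f x ≤ maximalFn g x :=
  maximalFn_le fun _ _ hr hx =>
    (mul_le_mul_right (lintegral_mono_ae (ae_restrict_of_ae h)) _).trans
      (average_le_maximalFn g hr hx)

lemma maximalFn_add_le {f : Euc n → ℝ≥0∞} (hf : Measurable f) (g : Euc n → ℝ≥0∞) (x : Euc n) :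
    maximalFn (fun y => f y + g y) x ≤ maximalFn f x + maximalFn g x := by
  refine maximalFn_le fun c r hr hx => ?_
  rw [lintegral_add_left hf, mul_add]
  exact add_le_add (average_le_maximalFn f hr hx) (average_le_maximalFn g hr hx)

lemma maximalFn_tsum_le {ι : Type*} [Countable ι] {f : ι → Euc n → ℝ≥0∞}
    (hf : ∀ i, Measurable (f i)) (x : Euc n) :
    maximalFn (fun y => ∑' i, f i y) x ≤ ∑' i, maximalFn (f i) x := by
  refine maximalFn_le fun c r hr hx => ?_
  rw [lintegral_tsum fun i => (hf i).aemeasurable, ← ENNReal.tsum_mul_left]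
  exact ENNReal.tsum_le_tsum fun i => average_le_maximalFn (f i) hr hx

lemma maximalFn_const_mul {f : Euc n → ℝ≥0∞} (hf : Measurable f) (a : ℝ≥0∞) (x : Euc n) :
    maximalFn (fun y => a * f y) x = a * maximalFn f x := by
  simp only [maximalFn, ENNReal.mul_iSup]
  refine iSup_congr fun c => iSup_congr fun r => iSup_congr fun _ => iSup_congr fun _ => ?_
  rw [lintegral_const_mul _ hf, mul_left_comm]

lemma isOpen_lt_maximalFn (f : Euc n → ℝ≥0∞) (t : ℝ≥0∞) : IsOpen {x | t < maximalFn f x} := by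
  have : {x | t < maximalFn f x} = ⋃ (c : Euc n) (r : ℝ) (_ : 0 < r)
      (_ : t < (volume (Metric.ball c r))⁻¹ * ∫⁻ y in Metric.ball c r, f y), Metric.ball c r := by
    ext x
    simp only [maximalFn, mem_ofPred_eq, lt_iSup_iff, mem_iUnion, exists_prop]
    exact exists₂_congr fun c r => and_congr_right fun _ => and_comm
  rw [this]
  exact isOpen_iUnion fun c => isOpen_iUnion fun r => isOpen_iUnion fun _ =>
    isOpen_iUnion fun _ => Metric.isOpen_ball

lemma measurable_maximalFn (f : Euc n → ℝ≥0∞) : Measurable (maximalFn f) :=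
  measurable_of_Ioi fun t => (isOpen_lt_maximalFn f t).measurableSet

lemma volume_ball_ne_zero (c : Euc n) {r : ℝ} (hr : 0 < r) : volume (Metric.ball c r) ≠ 0 :=
  (Metric.measure_ball_pos volume c hr).ne'

lemma volume_ball_ne_top (c : Euc n) (r : ℝ) : volume (Metric.ball c r) ≠ ∞ :=
  measure_ball_lt_top.ne

lemma volume_ball_eq (c : Euc n) {r : ℝ} (hr : 0 < r) :
    volume (Metric.ball c r) = ENNReal.ofReal (r ^ n) * volume (Metric.ball (0 : Euc n) 1) := by
  simpa using Measure.addHaar_ball_of_pos volume c hr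

/-- The weak type `(1,1)` inequality, by the Vitali covering lemma. -/
lemma mul_volume_lt_maximalFn_le (f : Euc n → ℝ≥0∞) (t : ℝ≥0∞) :
    t * volume {x | t < maximalFn f x} ≤ 5 ^ n * ∫⁻ y, f y := by
  rw [(isOpen_lt_maximalFn f t).measure_eq_iSup_isCompact]
  simp only [ENNReal.mul_iSup]
  refine iSup₂_le fun K hKU => iSup_le fun hK => ?_
  have hsel : ∀ x : K, ∃ (c : Euc n) (r : ℝ), 0 < r ∧ (x : Euc n) ∈ Metric.ball c r ∧
      t < (volume (Metric.ball c r))⁻¹ * ∫⁻ y in Metric.ball c r, f y := by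
    intro x
    simpa only [maximalFn, mem_ofPred_eq, lt_iSup_iff, exists_prop] using hKU x.2
  choose c r hr hmem hlt using hsel
  obtain ⟨s, hs⟩ := hK.elim_finite_subcover (fun x : K => Metric.ball (c x) (r x))
    (fun _ => Metric.isOpen_ball) (fun x hx => mem_iUnion.2 ⟨⟨x, hx⟩, hmem ⟨x, hx⟩⟩)
  obtain ⟨R, hR⟩ : ∃ R, ∀ a ∈ s, r a ≤ R :=
    (s.finite_toSet.image r).bddAbove.imp fun R hR a ha => hR ⟨a, ha, rfl⟩
  obtain ⟨u, hus, hdisj, hcov⟩ := Vitali.exists_disjoint_subfamily_covering_enlargement_closedBall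
    (s : Set K) c r R hR 5 (by norm_num)
  have hufin : u.Finite := s.finite_toSet.subset hus
  lift u to Finset K using hufin
  have hKcov : K ⊆ ⋃ b ∈ u, Metric.closedBall (c b) (5 * r b) := by
    intro x hx
    obtain ⟨a, ha, hxa⟩ := mem_iUnion₂.1 (hs hx)
    obtain ⟨b, hb, hab⟩ := hcov a ha
    exact mem_iUnion₂.2 ⟨b, hb, hab (Metric.ball_subset_closedBall hxa)⟩
  have hvol : ∀ b, volume (Metric.closedBall (c b) (5 * r b)) =
      5 ^ n * volume (Metric.ball (c b) (r b)) := by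
    intro b
    rw [Measure.addHaar_closedBall _ _ (by linarith [hr b]), volume_ball_eq _ (hr b), mul_pow,
      ENNReal.ofReal_mul (by positivity), finrank_euclideanSpace_fin, mul_assoc,
      ENNReal.ofReal_pow (by norm_num)]
    norm_num
  have hball : ∀ b, t * volume (Metric.ball (c b) (r b)) ≤
      ∫⁻ y in Metric.ball (c b) (r b), f y := by
    intro b
    refine (mul_le_mul_left (hlt b).le _).trans_eq ?_
    rw [mul_comm, ← mul_assoc, ENNReal.mul_inv_cancel (volume_ball_ne_zero _ (hr b))
      (volume_ball_ne_top _ _), one_mul]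
  calc t * volume K ≤ t * ∑ b ∈ u, volume (Metric.closedBall (c b) (5 * r b)) :=
        mul_le_mul_right ((measure_mono hKcov).trans (measure_biUnion_finset_le _ _)) _
    _ = 5 ^ n * ∑ b ∈ u, t * volume (Metric.ball (c b) (r b)) := by
        simp only [hvol, Finset.mul_sum, mul_left_comm]
    _ ≤ 5 ^ n * ∑ b ∈ u, ∫⁻ y in Metric.ball (c b) (r b), f y := by
        gcongr with b
        exact hball b
    _ = 5 ^ n * ∫⁻ y in ⋃ b ∈ u, Metric.ball (c b) (r b), f y := by
        rw [lintegral_biUnion_finset _ fun _ _ => measurableSet_ball]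
        exact hdisj.mono fun _ => Metric.ball_subset_closedBall
    _ ≤ 5 ^ n * ∫⁻ y, f y := by gcongr; exact Measure.restrict_le_self

end

section

variable {n : ℕ}

lemma two_rpow_ne_zero (x : ℝ) : (2 : ℝ≥0∞) ^ x ≠ 0 := by simp [ENNReal.rpow_eq_zero_iff]

lemma two_rpow_ne_top (x : ℝ) : (2 : ℝ≥0∞) ^ x ≠ ∞ := by simp [ENNReal.rpow_eq_top_iff]

lemma two_rpow_add (x y : ℝ) : (2 : ℝ≥0∞) ^ (x + y) = 2 ^ x * 2 ^ y :=
  ENNReal.rpow_add _ _ two_ne_zero ENNReal.ofNat_ne_top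

lemma two_rpow_mono {x y : ℝ} (h : x ≤ y) : (2 : ℝ≥0∞) ^ x ≤ 2 ^ y :=
  ENNReal.rpow_le_rpow_of_exponent_le one_le_two h

/-- The sum of the two-sided geometric weights `2^{-ε|k|}`. -/
def decaySum (ε : ℝ) : ℝ≥0∞ := ∑' k : ℤ, (2 : ℝ≥0∞) ^ (-(ε * |(k : ℝ)|))

lemma decaySum_ne_top {ε : ℝ} (hε : 0 < ε) : decaySum ε ≠ ∞ := by
  have hgeom : Summable fun k : ℕ => (2 : ℝ) ^ (-(ε * (k : ℝ))) := by
    have h1 : (2 : ℝ) ^ (-ε) < 1 := Real.rpow_lt_one_of_one_lt_of_neg one_lt_two (by linarith)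
    refine (summable_geometric_of_lt_one (by positivity) h1).congr fun k => ?_
    rw [← Real.rpow_natCast, ← Real.rpow_mul zero_le_two]
    ring_nf
  have hsum : Summable fun k : ℤ => (2 : ℝ) ^ (-(ε * |(k : ℝ)|)) :=
    Summable.of_nat_of_neg (by simpa using hgeom) (by simpa using hgeom)
  have := hsum.tsum_ofReal_ne_top
  simpa only [decaySum, ← ENNReal.ofReal_rpow_of_pos (zero_lt_two' ℝ), ENNReal.ofReal_ofNat]
    using this

lemma decaySum_ne_zero (ε : ℝ) : decaySum ε ≠ 0 := by
  intro h
  have := ENNReal.tsum_eq_zero.1 h 0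
  simp at this

lemma exists_two_rpow_lt_le {a : ℝ≥0∞} (h0 : a ≠ 0) (h1 : a ≠ ∞) :
    ∃ m : ℤ, (2 : ℝ≥0∞) ^ (m : ℝ) < a ∧ a ≤ 2 ^ ((m : ℝ) + 1) := by
  obtain ⟨m, hm⟩ := ENNReal.exists_mem_Ioc_zpow h0 h1 one_lt_two ENNReal.ofNat_ne_top
  refine ⟨m, ?_, ?_⟩
  · simpa [ENNReal.rpow_intCast] using hm.1
  · have := hm.2
    rw [← ENNReal.rpow_intCast] at this
    simpa using this

lemma rpow_le_tsum_dyadic (a : ℝ≥0∞) {r : ℝ} (hr : 0 < r) :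
    a ^ r ≤ ∑' j : ℤ, (4 * (2 : ℝ≥0∞) ^ (j : ℝ)) ^ r *
      {t : ℝ≥0∞ | 2 * (2 : ℝ≥0∞) ^ (j : ℝ) < t}.indicator 1 a := by
  rcases eq_or_ne a 0 with rfl | h0
  · simp [ENNReal.zero_rpow_of_pos hr]
  rcases eq_or_ne a ∞ with rfl | h1
  · have hone : ∀ j : ℕ, (1 : ℝ≥0∞) ≤ (4 * (2 : ℝ≥0∞) ^ (((j : ℤ) : ℝ))) ^ r *
        {t : ℝ≥0∞ | 2 * (2 : ℝ≥0∞) ^ (((j : ℤ) : ℝ)) < t}.indicator 1 ∞ := by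
      intro j
      rw [indicator_of_mem]
      · simp only [Pi.one_apply, mul_one]
        refine ENNReal.one_le_rpow ?_ hr
        have h2 : (1 : ℝ≥0∞) ≤ 2 ^ (((j : ℤ) : ℝ)) := by
          simpa using two_rpow_mono (x := 0) (y := ((j : ℤ) : ℝ)) (by positivity)
        calc (1 : ℝ≥0∞) = 1 * 1 := (one_mul 1).symm
          _ ≤ _ := mul_le_mul' (by norm_num) h2
      · exact (ENNReal.mul_ne_top ENNReal.ofNat_ne_top (two_rpow_ne_top _)).lt_top
    have h2 := ENNReal.tsum_comp_le_tsum_of_injective (Nat.cast_injective (R := ℤ))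
      (fun j : ℤ => (4 * (2 : ℝ≥0∞) ^ (j : ℝ)) ^ r *
        {t : ℝ≥0∞ | 2 * (2 : ℝ≥0∞) ^ (j : ℝ) < t}.indicator 1 ∞)
    refine le_trans ?_ h2
    refine le_trans ?_ (ENNReal.tsum_le_tsum hone)
    rw [ENNReal.tsum_const_eq_top_of_ne_zero one_ne_zero]
    exact le_top
  · obtain ⟨m, hm, hm'⟩ := exists_two_rpow_lt_le h0 h1
    refine le_trans ?_ (ENNReal.le_tsum (m - 1))
    have e1 : 2 * (2 : ℝ≥0∞) ^ (((m - 1 : ℤ) : ℝ)) = 2 ^ (m : ℝ) := by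
      nth_rewrite 1 [← ENNReal.rpow_one 2]
      rw [← two_rpow_add]
      push_cast
      ring_nf
    have e2 : 4 * (2 : ℝ≥0∞) ^ (((m - 1 : ℤ) : ℝ)) = 2 ^ ((m : ℝ) + 1) := by
      rw [show (4 : ℝ≥0∞) = 2 * 2 by norm_num, mul_assoc, e1, two_rpow_add, ENNReal.rpow_one,
        mul_comm]
    rw [e1, e2, indicator_of_mem (show a ∈ {t : ℝ≥0∞ | (2 : ℝ≥0∞) ^ (m : ℝ) < t} from hm)]
    simpa using ENNReal.rpow_le_rpow hm' hr.le

lemma mul_tsum_dyadic_le (a : ℝ≥0∞) {s : ℝ} (hs : 0 < s) :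
    a * ∑' j : ℤ, ((2 : ℝ≥0∞) ^ (j : ℝ)) ^ s *
      {t : ℝ≥0∞ | (2 : ℝ≥0∞) ^ (j : ℝ) < t}.indicator 1 a ≤ decaySum s * a ^ (1 + s) := by
  rcases eq_or_ne a 0 with rfl | h0
  · simp
  rcases eq_or_ne a ∞ with rfl | h1
  · rw [ENNReal.top_rpow_of_pos (by linarith), ENNReal.mul_top (decaySum_ne_zero s)]
    exact le_top
  obtain ⟨m, hm, hm'⟩ := exists_two_rpow_lt_le h0 h1
  have key : ∀ j : ℤ, ((2 : ℝ≥0∞) ^ (j : ℝ)) ^ s *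
      {t : ℝ≥0∞ | (2 : ℝ≥0∞) ^ (j : ℝ) < t}.indicator 1 a ≤
        a ^ s * 2 ^ (-(s * |((j - m : ℤ) : ℝ)|)) := by
    intro j
    by_cases hj : (2 : ℝ≥0∞) ^ (j : ℝ) < a
    · have hjm : j ≤ m := by
        by_contra hlt
        have : ((m : ℝ) + 1) ≤ j := by exact_mod_cast not_le.1 hlt
        exact absurd (hj.trans_le (hm'.trans (two_rpow_mono this))) (lt_irrefl _)
      rw [indicator_of_mem (by exact hj), Pi.one_apply, mul_one]
      have habs : |((j - m : ℤ) : ℝ)| = m - j := by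
        rw [abs_of_nonpos (by exact_mod_cast sub_nonpos.2 hjm)]
        push_cast
        ring
      calc ((2 : ℝ≥0∞) ^ (j : ℝ)) ^ s
          = ((2 : ℝ≥0∞) ^ (m : ℝ)) ^ s * 2 ^ (-(s * |((j - m : ℤ) : ℝ)|)) := by
            rw [habs, ← ENNReal.rpow_mul, ← ENNReal.rpow_mul, ← two_rpow_add]
            ring_nf
        _ ≤ _ := by gcongr
    · rw [indicator_of_notMem (by exact hj), mul_zero]
      exact zero_le
  calc _ ≤ a * ∑' j : ℤ, a ^ s * 2 ^ (-(s * |((j - m : ℤ) : ℝ)|)) := by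
        exact mul_le_mul_right (ENNReal.tsum_le_tsum key) _
    _ = a * (a ^ s * decaySum s) := by
        rw [ENNReal.tsum_mul_left, decaySum,
          ← (Equiv.subRight m).tsum_eq fun k : ℤ => (2 : ℝ≥0∞) ^ (-(s * |(k : ℝ)|))]
        rfl
    _ = _ := by
        rw [ENNReal.rpow_add _ _ h0 h1, ENNReal.rpow_one]
        ring

/-- Chebyshev-type bound for the level sets of `Mf` by the part of `f` above half the level. -/
lemma mul_volume_two_mul_lt_maximalFn_le {f : Euc n → ℝ≥0∞} (hf : Measurable f) {t : ℝ≥0∞}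
    (ht : t ≠ ∞) :
    t * volume {x | 2 * t < maximalFn f x} ≤
      5 ^ n * ∫⁻ y, f y * {u : ℝ≥0∞ | t < u}.indicator 1 (f y) := by
  have hmeas : Measurable fun y => f y * {u : ℝ≥0∞ | t < u}.indicator 1 (f y) :=
    hf.mul ((measurable_one.indicator measurableSet_Ioi).comp hf)
  refine le_trans ?_ (mul_volume_lt_maximalFn_le _ t)
  gcongr t * volume ?_
  intro x hx
  have hle : maximalFn f x ≤
      maximalFn (fun y => f y * {u : ℝ≥0∞ | t < u}.indicator 1 (f y)) x + t := by
    refine (maximalFn_mono_ae (g := fun y => f y * {u : ℝ≥0∞ | t < u}.indicator 1 (f y) + t)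
      (.of_forall fun y => ?_) x).trans ((maximalFn_add_le hmeas _ x).trans ?_)
    · by_cases h : t < f y
      · simp [h]
      · simp [h, not_lt.1 h]
    · gcongr
      refine maximalFn_le fun c r hr _ => ?_
      rw [setLIntegral_const, mul_left_comm, ENNReal.inv_mul_cancel (volume_ball_ne_zero c hr)
        (volume_ball_ne_top c r), mul_one]
  have hx' : 2 * t < maximalFn f x := hx
  rw [two_mul] at hx'
  exact (ENNReal.add_lt_add_iff_right ht).1 (hx'.trans_le hle)

/-- The Hardy–Littlewood maximal theorem on `L^r`, `1 < r < ∞`. -/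
lemma lintegral_maximalFn_rpow_le (n : ℕ) {r : ℝ} (hr : 1 < r) :
    ∃ K : ℝ≥0∞, K ≠ ∞ ∧ ∀ f : Euc n → ℝ≥0∞, Measurable f →
      ∫⁻ x, maximalFn f x ^ r ≤ K * ∫⁻ x, f x ^ r := by
  have hr0 : 0 < r := by linarith
  refine ⟨4 ^ r * 5 ^ n * decaySum (r - 1), ?_, fun f hf => ?_⟩
  · exact ENNReal.mul_ne_top (ENNReal.mul_ne_top (ENNReal.rpow_ne_top_of_nonneg hr0.le (by simp))
      (by simp)) (decaySum_ne_top (by linarith))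
  have hmeas : ∀ j : ℤ, Measurable fun y =>
      f y * {u : ℝ≥0∞ | (2 : ℝ≥0∞) ^ (j : ℝ) < u}.indicator 1 (f y) := fun j =>
    hf.mul ((measurable_one.indicator measurableSet_Ioi).comp hf)
  calc ∫⁻ x, maximalFn f x ^ r
      ≤ ∫⁻ x, ∑' j : ℤ, (4 * (2 : ℝ≥0∞) ^ (j : ℝ)) ^ r *
          {t : ℝ≥0∞ | 2 * (2 : ℝ≥0∞) ^ (j : ℝ) < t}.indicator 1 (maximalFn f x) :=
        lintegral_mono fun x => rpow_le_tsum_dyadic _ hr0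
    _ = ∑' j : ℤ, (4 * (2 : ℝ≥0∞) ^ (j : ℝ)) ^ r *
          volume {x | 2 * (2 : ℝ≥0∞) ^ (j : ℝ) < maximalFn f x} := by
        have hm : ∀ j : ℤ, Measurable fun x => {t : ℝ≥0∞ | 2 * (2 : ℝ≥0∞) ^ (j : ℝ) < t}.indicator
            (1 : ℝ≥0∞ → ℝ≥0∞) (maximalFn f x) := fun j =>
          (measurable_one.indicator measurableSet_Ioi).comp (measurable_maximalFn f)
        rw [lintegral_tsum fun j => ((hm j).const_mul _).aemeasurable]
        refine tsum_congr fun j => ?_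
        rw [lintegral_const_mul _ (hm j)]
        congr 1
        rw [← lintegral_indicator_one (isOpen_lt_maximalFn f _).measurableSet]
        rfl
    _ = ∑' j : ℤ, 4 ^ r * ((2 : ℝ≥0∞) ^ (j : ℝ)) ^ (r - 1) * ((2 : ℝ≥0∞) ^ (j : ℝ) *
          volume {x | 2 * (2 : ℝ≥0∞) ^ (j : ℝ) < maximalFn f x}) := by
        refine tsum_congr fun j => ?_
        rw [ENNReal.mul_rpow_of_nonneg _ _ hr0.le]
        nth_rewrite 2 [show r = (r - 1) + 1 by ring]
        rw [ENNReal.rpow_add _ _ (two_rpow_ne_zero _) (two_rpow_ne_top _), ENNReal.rpow_one]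
        ring
    _ ≤ ∑' j : ℤ, 4 ^ r * ((2 : ℝ≥0∞) ^ (j : ℝ)) ^ (r - 1) * (5 ^ n *
          ∫⁻ y, f y * {u : ℝ≥0∞ | (2 : ℝ≥0∞) ^ (j : ℝ) < u}.indicator 1 (f y)) := by
        exact ENNReal.tsum_le_tsum fun j =>
          mul_le_mul_right (mul_volume_two_mul_lt_maximalFn_le hf (two_rpow_ne_top _)) _
    _ = 4 ^ r * 5 ^ n * ∫⁻ y, f y * ∑' j : ℤ, ((2 : ℝ≥0∞) ^ (j : ℝ)) ^ (r - 1) *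
          {u : ℝ≥0∞ | (2 : ℝ≥0∞) ^ (j : ℝ) < u}.indicator 1 (f y) := by
        simp only [← ENNReal.tsum_mul_left]
        rw [lintegral_tsum, ← ENNReal.tsum_mul_left]
        · refine tsum_congr fun j => ?_
          simp only [mul_left_comm (f _)]
          rw [lintegral_const_mul _ (hmeas j)]
          ring
        · intro j
          simp only [mul_left_comm (f _)]
          exact ((hmeas j).const_mul _).aemeasurable
    _ ≤ 4 ^ r * 5 ^ n * ∫⁻ y, decaySum (r - 1) * f y ^ (1 + (r - 1)) := by
        exact mul_le_mul_right (lintegral_mono fun y => mul_tsum_dyadic_le _ (by linarith)) _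
    _ = _ := by
        rw [lintegral_const_mul _ (hf.pow_const _), add_sub_cancel]
        ring

end

section

variable {n : ℕ} {q q' : Euc n → ℝ} {f g : Euc n → ℝ≥0∞}

lemma varNorm_le {lam : ℝ≥0∞} (h0 : 0 < lam) (h1 : lam ≠ ∞)
    (h : ∫⁻ x, (f x / lam) ^ q x ≤ 1) : varNorm q f ≤ lam :=
  iInf₂_le_of_le lam h0 (iInf₂_le h1 h)

lemma exists_of_varNorm_lt {a : ℝ≥0∞} (h : varNorm q f < a) :
    ∃ lam : ℝ≥0∞, 0 < lam ∧ lam < a ∧ lam ≠ ∞ ∧ ∫⁻ x, (f x / lam) ^ q x ≤ 1 := by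
  simp only [varNorm, iInf_lt_iff, exists_prop] at h
  obtain ⟨lam, h0, h1, h2, h3⟩ := h
  exact ⟨lam, h0, h3, h1, h2⟩

lemma le_mul_varNorm {X K : ℝ≥0∞} (hK0 : K ≠ 0) (hK : K ≠ ∞)
    (h : ∀ lam : ℝ≥0∞, 0 < lam → lam ≠ ∞ → ∫⁻ x, (f x / lam) ^ q x ≤ 1 → X ≤ K * lam) :
    X ≤ K * varNorm q f := by
  simp only [varNorm, ENNReal.mul_iInf_of_ne hK0 hK]
  exact le_iInf₂ fun lam h0 => le_iInf₂ fun h1 h2 => h lam h0 h1 h2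

lemma varNorm_congr_exponent {q₁ : Euc n → ℝ} (h : q =ᵐ[volume] q₁) (f : Euc n → ℝ≥0∞) :
    varNorm q f = varNorm q₁ f := by
  have : ∀ lam : ℝ≥0∞, ∫⁻ x, (f x / lam) ^ q x = ∫⁻ x, (f x / lam) ^ q₁ x := fun lam =>
    lintegral_congr_ae (h.mono fun x hx => by simp only [hx])
  simp only [varNorm, this]

lemma varNorm_mono_ae (hq : ∀ x, 0 ≤ q x) (h : f ≤ᵐ[volume] g) : varNorm q f ≤ varNorm q g := by
  rw [← one_mul (varNorm q g)]
  refine le_mul_varNorm one_ne_zero one_ne_top fun lam h0 h1 h2 => ?_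
  rw [one_mul]
  refine varNorm_le h0 h1 (le_trans (lintegral_mono_ae (h.mono fun x hx => ?_)) h2)
  exact ENNReal.rpow_le_rpow (ENNReal.div_le_div_right hx _) (hq x)

lemma varNorm_mono (hq : ∀ x, 0 ≤ q x) (h : ∀ x, f x ≤ g x) : varNorm q f ≤ varNorm q g :=
  varNorm_mono_ae hq (.of_forall h)

lemma inv_rpow_le_inv {K : ℝ≥0∞} (hK : 1 ≤ K) {r : ℝ} (hr : 1 ≤ r) : K⁻¹ ^ r ≤ K⁻¹ := by
  simpa using ENNReal.rpow_le_rpow_of_exponent_ge (ENNReal.inv_le_one.2 hK) hr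

lemma lintegral_div_mul_rpow_le_one (hq : ∀ x, 1 ≤ q x) {lam K : ℝ≥0∞} (hK : 1 ≤ K) (hK' : K ≠ ∞)
    (h : ∫⁻ x, (f x / lam) ^ q x ≤ K) : ∫⁻ x, (f x / (K * lam)) ^ q x ≤ 1 := by
  have hK0 : K ≠ 0 := (zero_lt_one.trans_le hK).ne'
  calc ∫⁻ x, (f x / (K * lam)) ^ q x ≤ ∫⁻ x, K⁻¹ * (f x / lam) ^ q x := by
        refine lintegral_mono fun x => ?_
        simp only
        rw [div_eq_mul_inv, ENNReal.mul_inv (.inl hK0) (.inl hK'), mul_left_comm,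
          ENNReal.mul_rpow_of_nonneg _ _ (by linarith [hq x]), ← div_eq_mul_inv]
        gcongr
        exact inv_rpow_le_inv hK (hq x)
    _ = K⁻¹ * ∫⁻ x, (f x / lam) ^ q x := lintegral_const_mul' _ _ (ENNReal.inv_ne_top.2 hK0)
    _ ≤ K⁻¹ * K := by gcongr
    _ ≤ 1 := ENNReal.inv_mul_le_one K

lemma varNorm_add_le (hqm : Measurable q) (hq : ∀ x, 1 ≤ q x) (hf : Measurable f) :
    varNorm q (fun x => f x + g x) ≤ 4 * (varNorm q f + varNorm q g) := by
  refine le_trans ?_ (mul_le_mul_right (max_le le_self_add le_add_self) 4)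
  by_contra! hlt
  have h4 : (4 : ℝ≥0∞) ≠ 0 := by norm_num
  have h4' : (4 : ℝ≥0∞) ≠ ∞ := ENNReal.ofNat_ne_top
  have hlt' : max (varNorm q f) (varNorm q g) < varNorm q (fun x => f x + g x) / 4 := by
    rwa [ENNReal.lt_div_iff_mul_lt (.inl h4) (.inl h4'), mul_comm]
  obtain ⟨l₁, h10, h11, h12, h13⟩ := exists_of_varNorm_lt ((le_max_left _ _).trans_lt hlt')
  obtain ⟨l₂, h20, h21, h22, h23⟩ := exists_of_varNorm_lt ((le_max_right _ _).trans_lt hlt')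
  set ν := max l₁ l₂ with hν
  have hν0 : 0 < ν := h10.trans_le (le_max_left _ _)
  have hν1 : ν ≠ ∞ := (max_lt h12.lt_top h22.lt_top).ne
  have hbound : ∀ x, ((f x + g x) / (2 * ν)) ^ q x ≤ (f x / l₁) ^ q x + (g x / l₂) ^ q x := by
    intro x
    have hq0 : 0 ≤ q x := by linarith [hq x]
    have hmax : (f x + g x) / (2 * ν) ≤ max (f x / l₁) (g x / l₂) := by
      have h2 : f x + g x ≤ 2 * max (f x) (g x) := by
        rw [two_mul]; exact add_le_add (le_max_left _ _) (le_max_right _ _)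
      calc (f x + g x) / (2 * ν) ≤ (2 * max (f x) (g x)) / (2 * ν) := by gcongr
        _ = max (f x) (g x) / ν := ENNReal.mul_div_mul_left _ _ two_ne_zero ENNReal.ofNat_ne_top
        _ = max (f x / ν) (g x / ν) := by
          exact Monotone.map_max (f := fun t : ℝ≥0∞ => t / ν)
            fun a b hab => ENNReal.div_le_div_right hab ν
        _ ≤ _ := max_le_max (ENNReal.div_le_div_left (le_max_left _ _) _)
          (ENNReal.div_le_div_left (le_max_right _ _) _)
    refine (ENNReal.rpow_le_rpow hmax hq0).trans ?_
    rcases max_choice (f x / l₁) (g x / l₂) with h | h <;> rw [h]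
    exacts [le_self_add, le_add_self]
  have hmod : ∫⁻ x, ((f x + g x) / (2 * ν)) ^ q x ≤ 2 := by
    refine (lintegral_mono hbound).trans ?_
    rw [lintegral_add_left ((hf.div_const _).pow hqm)]
    exact (add_le_add h13 h23).trans_eq one_add_one_eq_two
  have h := lintegral_div_mul_rpow_le_one hq one_le_two ENNReal.ofNat_ne_top hmod
  rw [← mul_assoc, show (2 : ℝ≥0∞) * 2 = 4 by norm_num] at h
  have h' := varNorm_le (ENNReal.mul_pos h4 hν0.ne') (ENNReal.mul_ne_top h4' hν1) h
  have h'' : ν < varNorm q (fun x => f x + g x) / 4 := max_lt h11 h21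
  rw [ENNReal.lt_div_iff_mul_lt (.inl h4) (.inl h4'), mul_comm] at h''
  exact absurd h' (not_le.2 h'')

lemma varNorm_zero (hq : ∀ x, 0 < q x) : varNorm q (fun _ => 0) = 0 := by
  refine le_antisymm (ENNReal.le_of_forall_pos_le_add fun ε hε _ => ?_) zero_le
  rw [zero_add]
  exact varNorm_le (by exact_mod_cast hε) ENNReal.coe_ne_top
    (by simp [ENNReal.zero_rpow_of_pos (hq _)])

lemma varNorm_const_mul_le_of_ne {c : ℝ≥0∞} (h0 : c ≠ 0) (h1 : c ≠ ∞) :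
    varNorm q (fun x => c * f x) ≤ c * varNorm q f := by
  refine le_mul_varNorm h0 h1 fun lam l0 l1 hl => ?_
  refine varNorm_le (ENNReal.mul_pos h0 l0.ne') (ENNReal.mul_ne_top h1 l1) ?_
  simpa only [ENNReal.mul_div_mul_left _ _ h0 h1] using hl

lemma varNorm_const_mul_le (hq : ∀ x, 0 < q x) {c : ℝ≥0∞} (hf : varNorm q f ≠ 0) :
    varNorm q (fun x => c * f x) ≤ c * varNorm q f := by
  rcases eq_or_ne c 0 with rfl | h0
  · simp [varNorm_zero hq]
  rcases eq_or_ne c ∞ with rfl | h1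
  · rw [ENNReal.top_mul hf]; exact le_top
  exact varNorm_const_mul_le_of_ne h0 h1

lemma varNorm_indicator_ne_top (hq : ∀ x, 1 ≤ q x) {E : Set (Euc n)} (hE : volume E ≠ ∞) :
    varNorm q (E.indicator 1) ≠ ∞ := by
  have hmod : ∫⁻ x, (E.indicator 1 x / 1) ^ q x ≤ max 1 (volume E) := by
    refine le_trans ?_ (le_max_right _ _)
    refine le_trans (lintegral_mono fun x => ?_) (lintegral_indicator_one_le E)
    by_cases hx : x ∈ E
    · simp [hx]
    · simp [hx, ENNReal.zero_rpow_of_pos (zero_lt_one.trans_le (hq x))]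
  have hne : max 1 (volume E) ≠ ∞ := (max_lt one_lt_top hE.lt_top).ne
  have h := lintegral_div_mul_rpow_le_one hq (le_max_left _ _) hne hmod
  rw [mul_one] at h
  exact ((varNorm_le (zero_lt_one.trans_le (le_max_left _ _)) hne h).trans_lt hne.lt_top).ne

lemma varNorm_indicator_ne_zero (hq : ∀ x, 1 ≤ q x) {E : Set (Euc n)} (hEm : MeasurableSet E)
    (hE : volume E ≠ 0) : varNorm q (E.indicator 1) ≠ 0 := by
  intro h
  obtain ⟨lam, h0, h1, h2, h3⟩ := exists_of_varNorm_lt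
    (show varNorm q (E.indicator 1) < min 1 (volume E) by rw [h]; exact lt_min one_pos hE.bot_lt)
  have hle : lam⁻¹ * volume E ≤ 1 := by
    refine le_trans ?_ h3
    rw [← lintegral_indicator_one hEm, ← lintegral_const_mul' _ _ (ENNReal.inv_ne_top.2 h0.ne')]
    refine lintegral_mono fun x => ?_
    by_cases hx : x ∈ E
    · simp only [indicator_of_mem hx, Pi.one_apply, mul_one, one_div]
      simpa using ENNReal.rpow_le_rpow_of_exponent_le
        (ENNReal.one_le_inv.2 (h1.le.trans (min_le_left _ _))) (hq x)
    · simp [hx]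
  have : volume E ≤ lam := by
    have := mul_le_mul_right hle lam
    rwa [← mul_assoc, ENNReal.mul_inv_cancel h0.ne' h2, one_mul, mul_one] at this
  exact absurd (h1.trans_le (min_le_right _ _)) (not_lt.2 this)

/-- Hölder's inequality for variable exponents. -/
lemma lintegral_mul_le_varNorm (hqm : Measurable q) (hqq' : ∀ x, (q x).HolderConjugate (q' x))
    (hf : Measurable f) (hg0 : varNorm q' g ≠ 0) (hg1 : varNorm q' g ≠ ∞) :
    ∫⁻ x, f x * g x ≤ 2 * varNorm q' g * varNorm q f := by
  refine le_mul_varNorm (mul_ne_zero two_ne_zero hg0) (ENNReal.mul_ne_top ENNReal.ofNat_ne_top hg1)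
    fun lam h0 h1 h2 => ?_
  rw [mul_right_comm]
  refine le_mul_varNorm (mul_ne_zero two_ne_zero h0.ne')
    (ENNReal.mul_ne_top ENNReal.ofNat_ne_top h1) fun mu m0 m1 m2 => ?_
  have hpt : ∀ x, f x * g x ≤ lam * mu * ((f x / lam) ^ q x + (g x / mu) ^ q' x) := by
    intro x
    have hy := ENNReal.young_inequality (f x / lam) (g x / mu) (hqq' x)
    have e : f x * g x = lam * mu * ((f x / lam) * (g x / mu)) := by
      rw [mul_mul_mul_comm, ENNReal.mul_div_cancel h0.ne' h1, ENNReal.mul_div_cancel m0.ne' m1]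
    rw [e]
    gcongr
    refine hy.trans (add_le_add ?_ ?_) <;> refine ENNReal.div_le_of_le_mul ?_
    · exact le_mul_of_one_le_right' (by simpa using (hqq' x).lt.le)
    · exact le_mul_of_one_le_right' (by simpa using (hqq' x).symm.lt.le)
  calc ∫⁻ x, f x * g x ≤ ∫⁻ x, lam * mu * ((f x / lam) ^ q x + (g x / mu) ^ q' x) :=
        lintegral_mono hpt
    _ = lam * mu * ((∫⁻ x, (f x / lam) ^ q x) + ∫⁻ x, (g x / mu) ^ q' x) := by
        rw [lintegral_const_mul' _ _ (ENNReal.mul_ne_top h1 m1),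
          lintegral_add_left ((hf.div_const _).pow hqm)]
    _ ≤ lam * mu * (1 + 1) := by gcongr
    _ = 2 * lam * mu := by rw [one_add_one_eq_two]; ring

end

section

variable {n : ℕ} {q : Euc n → ℝ}

lemma rpow_average_le {f : Euc n → ℝ≥0∞} (hf : Measurable f) (c : Euc n) {r : ℝ} (hr : 0 < r)
    {a : ℝ} (ha : 1 ≤ a) :
    ((volume (Metric.ball c r))⁻¹ * ∫⁻ y in Metric.ball c r, f y) ^ a ≤
      (volume (Metric.ball c r))⁻¹ * ∫⁻ y in Metric.ball c r, f y ^ a := by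
  have ha0 : 0 < a := by linarith
  have := ProbabilityTheory.cond_isProbabilityMeasure_of_finite (μ := (volume : Measure (Euc n)))
    (volume_ball_ne_zero c hr) (volume_ball_ne_top c r)
  have h := eLpNorm'_le_eLpNorm'_of_exponent_le one_pos ha
    (ProbabilityTheory.cond (volume : Measure (Euc n)) (Metric.ball c r))
    hf.aestronglyMeasurable
  simp only [eLpNorm', ProbabilityTheory.cond, lintegral_smul_measure, enorm_eq_self,
    ENNReal.rpow_one, one_div, inv_one, smul_eq_mul] at h
  rwa [ENNReal.le_rpow_inv_iff ha0] at h

lemma one_le_log_exp_one_add {t : ℝ} (ht : 0 ≤ t) : 1 ≤ Real.log (Real.exp 1 + t) := by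
  rw [Real.le_log_iff_exp_le (by positivity)]
  linarith

lemma exists_inv_volume_ball_rpow_le (n : ℕ) {C : ℝ} (hC : 0 ≤ C) :
    ∃ D : ℝ≥0∞, 1 ≤ D ∧ D ≠ ∞ ∧ ∀ (c : Euc n) (r e : ℝ), 0 < r → 0 ≤ e →
      e ≤ C / Real.log (Real.exp 1 + 1 / (2 * r)) → (volume (Metric.ball c r))⁻¹ ^ e ≤ D := by
  set v := (volume (Metric.ball (0 : Euc n) 1)).toReal with hv
  have hv0 : 0 < v := ENNReal.toReal_pos (volume_ball_ne_zero _ one_pos) (volume_ball_ne_top _ _)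
  refine ⟨ENNReal.ofReal (Real.exp (C * (n + n * Real.log 2 + |Real.log v|))), ?_,
    ENNReal.ofReal_ne_top, fun c r e hr he0 he => ?_⟩
  · have := Real.log_nonneg (one_le_two : (1 : ℝ) ≤ 2)
    simpa using by positivity
  have hlog2 := Real.log_nonneg (one_le_two : (1 : ℝ) ≤ 2)
  have hB : volume (Metric.ball c r) = ENNReal.ofReal (r ^ n * v) := by
    rw [volume_ball_eq c hr, ENNReal.ofReal_mul (by positivity), hv,
      ENNReal.ofReal_toReal (volume_ball_ne_top _ _)]
  have hpos : 0 < r ^ n * v := by positivity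
  rw [hB, ← ENNReal.ofReal_inv_of_pos hpos, ENNReal.ofReal_rpow_of_pos (by positivity)]
  refine ENNReal.ofReal_le_ofReal ?_
  rw [Real.rpow_def_of_pos (by positivity), Real.exp_le_exp, Real.log_inv,
    Real.log_mul (by positivity) hv0.ne', Real.log_pow]
  set L := Real.log (Real.exp 1 + 1 / (2 * r)) with hL
  have hL1 : 1 ≤ L := one_le_log_exp_one_add (by positivity)
  have hr' : -Real.log r ≤ L + Real.log 2 := by
    have h1 : Real.log (1 / (2 * r)) ≤ L :=
      Real.log_le_log (by positivity) (by linarith [Real.exp_pos 1])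
    rw [one_div, Real.log_inv, Real.log_mul two_ne_zero hr.ne'] at h1
    linarith
  have hbr : -(n * Real.log r + Real.log v) ≤ L * (n + n * Real.log 2 + |Real.log v|) := by
    have h1 : (n : ℝ) * -Real.log r ≤ n * (L + Real.log 2) := by gcongr
    have h2 : (n : ℝ) * Real.log 2 ≤ L * (n * Real.log 2) :=
      le_mul_of_one_le_left (by positivity) hL1
    have h3 : |Real.log v| ≤ L * |Real.log v| := le_mul_of_one_le_left (by positivity) hL1
    linarith [neg_le_abs (Real.log v)]
  calc -(n * Real.log r + Real.log v) * e ≤ L * (n + n * Real.log 2 + |Real.log v|) * e := by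
        gcongr
    _ ≤ L * (n + n * Real.log 2 + |Real.log v|) * (C / L) := by gcongr
    _ = _ := by field_simp

/-- The pointwise estimate for the part of a function where it is large. -/
lemma exists_maximalFn_rpow_le {qm : ℝ} (hqm : 1 ≤ qm) (hq : ∀ x, qm ≤ q x)
    {C : ℝ} (hC : 0 ≤ C)
    (hlog : ∀ x y : Euc n, x ≠ y → |q x - q y| ≤ C / Real.log (Real.exp 1 + 1 / dist x y)) :
    ∃ D : ℝ≥0∞, D ≠ ∞ ∧ ∀ f : Euc n → ℝ≥0∞, Measurable f → (∀ x, f x = 0 ∨ 1 ≤ f x) →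
      ∫⁻ x, f x ^ q x ≤ 1 →
        ∀ x, maximalFn f x ^ (q x / qm) ≤ D * maximalFn (fun y => f y ^ (q y / qm)) x := by
  obtain ⟨D, hD1, hD, hDB⟩ := exists_inv_volume_ball_rpow_le n hC
  refine ⟨D, hD, fun f hf hf01 hmod x => ?_⟩
  have hqm0 : 0 < qm := by linarith
  have hs1 : ∀ y, 1 ≤ q y / qm := fun y => (one_le_div hqm0).2 (hq y)
  have hs0 : 0 < q x / qm := by linarith [hs1 x]
  rw [← ENNReal.le_rpow_inv_iff hs0]
  refine maximalFn_le fun c r hr hx => ?_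
  rw [ENNReal.le_rpow_inv_iff hs0]
  set B := Metric.ball c r with hB
  set ω := C / Real.log (Real.exp 1 + 1 / (2 * r)) with hω
  have hL := one_le_log_exp_one_add (t := 1 / (2 * r)) (by positivity)
  have hω0 : 0 ≤ ω := div_nonneg hC (by linarith)
  set sB := max 1 (q x / qm - ω) with hsB
  have hsB1 : 1 ≤ sB := le_max_left _ _
  have hosc : ∀ y ∈ B, sB ≤ q y / qm := by
    intro y hy
    refine max_le (hs1 y) ?_
    rcases eq_or_ne x y with rfl | hxy
    · linarith
    have hd : dist x y ≤ 2 * r := by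
      have h1 : dist x c < r := hx
      have h2 : dist y c < r := hy
      linarith [dist_triangle_right x y c]
    have hd0 : 0 < dist x y := dist_pos.2 hxy
    have h3 : |q x - q y| ≤ ω := by
      refine (hlog x y hxy).trans ?_
      rw [hω]
      gcongr
    have h4 : q x / qm - q y / qm ≤ ω := by
      rw [← sub_div]
      exact (div_le_div_of_nonneg_right ((le_abs_self _).trans h3) hqm0.le).trans
        (div_le_self hω0 hqm)
    linarith
  set X := (volume B)⁻¹ * ∫⁻ y in B, f y ^ (q y / qm) with hX
  have hAX : ((volume B)⁻¹ * ∫⁻ y in B, f y) ^ sB ≤ X := by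
    refine (rpow_average_le hf c hr hsB1).trans (mul_le_mul_right ?_ _)
    refine setLIntegral_mono' measurableSet_ball fun y hy => ?_
    rcases hf01 y with h | h
    · simp [h, ENNReal.zero_rpow_of_pos (zero_lt_one.trans_le hsB1)]
    · exact ENNReal.rpow_le_rpow_of_exponent_le h (hosc y hy)
  have hXB : X ≤ (volume B)⁻¹ := by
    refine (mul_le_mul_right ?_ _).trans_eq (mul_one _)
    refine (setLIntegral_le_lintegral _ _).trans (le_trans (lintegral_mono fun y => ?_) hmod)
    rcases hf01 y with h | h
    · have := hq y
      simp [h, ENNReal.zero_rpow_of_pos (zero_lt_one.trans_le (hs1 y)),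
        ENNReal.zero_rpow_of_pos (show 0 < q y by linarith)]
    · exact ENNReal.rpow_le_rpow_of_exponent_le h
        (div_le_self (by linarith [hq y]) hqm)
  have hsB0 : 0 < sB := by linarith
  set e := (q x / qm - sB) / sB with he
  have he0 : 0 ≤ e := div_nonneg (by linarith [hosc x hx]) hsB0.le
  have heω : e ≤ ω := by
    refine (div_le_self (by linarith [hosc x hx]) hsB1).trans ?_
    linarith [le_max_right 1 (q x / qm - ω)]
  calc ((volume B)⁻¹ * ∫⁻ y in B, f y) ^ (q x / qm)
      = (((volume B)⁻¹ * ∫⁻ y in B, f y) ^ sB) ^ (1 + e) := by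
        rw [← ENNReal.rpow_mul]
        congr 1
        rw [he]
        field_simp
        ring
    _ ≤ X ^ (1 + e) := ENNReal.rpow_le_rpow hAX (by linarith)
    _ = X * X ^ e := by rw [ENNReal.rpow_add_of_nonneg _ _ zero_le_one he0, ENNReal.rpow_one]
    _ ≤ X * D := by
        gcongr
        exact (ENNReal.rpow_le_rpow hXB he0).trans (hDB c r e hr he0 heω)
    _ ≤ D * maximalFn (fun y => f y ^ (q y / qm)) x := by
        rw [mul_comm]
        gcongr
        exact average_le_maximalFn (fun y => f y ^ (q y / qm)) hr hx

/-- Two exponents that are close at infinity give comparable powers of a function bounded by `1`,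
up to an integrable remainder. -/
lemma rpow_le_mul_rpow_add {F : ℝ≥0∞} (hF : F ≤ 1) {a b C m : ℝ} (ha : 1 ≤ a) (hC : 0 ≤ C)
    (x : Euc n) (hab : |a - b| ≤ C / Real.log (Real.exp 1 + ‖x‖)) :
    F ^ a ≤ ENNReal.ofReal (Real.exp (m * C)) * F ^ b +
      ENNReal.ofReal ((Real.exp 1 + ‖x‖) ^ (-m)) := by
  set d := C / Real.log (Real.exp 1 + ‖x‖) with hd
  have hpos : 0 < Real.exp 1 + ‖x‖ := by positivity
  have hlog := one_le_log_exp_one_add (norm_nonneg x)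
  have hd0 : 0 ≤ d := div_nonneg hC (by linarith)
  set R := ENNReal.ofReal ((Real.exp 1 + ‖x‖) ^ (-m)) with hR
  rcases lt_or_ge F R with h | h
  · refine le_trans ?_ le_add_self
    calc F ^ a ≤ F ^ (1 : ℝ) := ENNReal.rpow_le_rpow_of_exponent_ge hF ha
      _ ≤ R := by rw [ENNReal.rpow_one]; exact h.le
  · refine le_trans ?_ le_self_add
    have hR0 : 0 < R := ENNReal.ofReal_pos.2 (by positivity)
    have hF0 : F ≠ 0 := (hR0.trans_le h).ne'
    have hF1 : F ≠ ∞ := (hF.trans_lt one_lt_top).ne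
    calc F ^ a ≤ F ^ (-d + b) :=
          ENNReal.rpow_le_rpow_of_exponent_ge hF (by linarith [neg_le_of_abs_le hab])
      _ = F ^ (-d) * F ^ b := ENNReal.rpow_add _ _ hF0 hF1
      _ ≤ R ^ (-d) * F ^ b := by
          rw [ENNReal.rpow_neg, ENNReal.rpow_neg]
          exact mul_le_mul_left (ENNReal.inv_le_inv.2 (ENNReal.rpow_le_rpow h hd0)) _
      _ = _ := by
          rw [hR, ENNReal.ofReal_rpow_of_pos (by positivity), ← Real.rpow_mul hpos.le,
            Real.rpow_def_of_pos hpos, hd]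
          congr 3
          field_simp

lemma lintegral_decay_ne_top (n : ℕ) :
    ∫⁻ x : Euc n, ENNReal.ofReal ((Real.exp 1 + ‖x‖) ^ (-((n : ℝ) + 1))) ≠ ∞ := by
  have h := (integrable_one_add_norm (E := Euc n) (μ := volume) (r := (n : ℝ) + 1)
    (by simp)).lintegral_lt_top
  refine (lt_of_le_of_lt (lintegral_mono fun x => ?_) h).ne
  refine ENNReal.ofReal_le_ofReal
    (Real.rpow_le_rpow_of_nonpos (by positivity) ?_ (by linarith [n.cast_nonneg (α := ℝ)]))
  linarith [Real.add_one_le_exp 1]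

/-- The modular estimate for the maximal function under log-Hölder continuity. -/
lemma exists_lintegral_maximalFn_rpow_exponent_le {qm qp qinf C : ℝ} (hqm : 1 < qm)
    (hq : ∀ x, qm ≤ q x ∧ q x ≤ qp) (hqmeas : Measurable q) (hC : 0 ≤ C)
    (hlog : ∀ x y : Euc n, x ≠ y → |q x - q y| ≤ C / Real.log (Real.exp 1 + 1 / dist x y))
    (hinf : ∀ x : Euc n, |q x - qinf| ≤ C / Real.log (Real.exp 1 + ‖x‖)) (hqinf : 1 < qinf) :
    ∃ K : ℝ≥0∞, 1 ≤ K ∧ K ≠ ∞ ∧ ∀ f : Euc n → ℝ≥0∞, Measurable f → ∫⁻ x, f x ^ q x ≤ 1 →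
      ∫⁻ x, maximalFn f x ^ q x ≤ K := by
  obtain ⟨D, hD, hlarge⟩ := exists_maximalFn_rpow_le hqm.le (fun x => (hq x).1) hC hlog
  obtain ⟨K₁, hK₁, hM₁⟩ := lintegral_maximalFn_rpow_le n hqm
  obtain ⟨K₂, hK₂, hM₂⟩ := lintegral_maximalFn_rpow_le n hqinf
  set R : Euc n → ℝ≥0∞ := fun x => ENNReal.ofReal ((Real.exp 1 + ‖x‖) ^ (-((n : ℝ) + 1))) with hR
  set E := ENNReal.ofReal (Real.exp (((n : ℝ) + 1) * C)) with hE
  have hE' : E ≠ ∞ := ENNReal.ofReal_ne_top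
  have hI : ∫⁻ x, R x ≠ ∞ := lintegral_decay_ne_top n
  have hRm : Measurable R := by fun_prop
  have hq1 : ∀ x, 1 < q x := fun x => hqm.trans_le (hq x).1
  have hqm0 : 0 < qm := by linarith
  set T := D ^ qm * K₁ + (E * (K₂ * (E + ∫⁻ x, R x)) + ∫⁻ x, R x) with hT
  refine ⟨max 1 (2 ^ (qp - 1) * T), le_max_left _ _, ?_, fun f hf hmod => ?_⟩
  · have hDq : D ^ qm ≠ ∞ := ENNReal.rpow_ne_top_of_nonneg hqm0.le hD
    have hT' : T ≠ ∞ := by finiteness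
    exact (max_lt one_lt_top (ENNReal.mul_lt_top (two_rpow_ne_top _).lt_top hT'.lt_top)).ne
  refine le_trans ?_ (le_max_right _ _)
  set f₁ : Euc n → ℝ≥0∞ := {x | 1 < f x}.indicator f with hf₁
  set f₂ : Euc n → ℝ≥0∞ := {x | 1 < f x}ᶜ.indicator f with hf₂
  have hset : MeasurableSet {x | 1 < f x} := measurableSet_lt measurable_const hf
  have hf₁m : Measurable f₁ := hf.indicator hset
  have hf₂m : Measurable f₂ := hf.indicator hset.compl
  have hmod₁ : ∫⁻ x, f₁ x ^ q x ≤ 1 := (lintegral_mono fun x =>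
    ENNReal.rpow_le_rpow (indicator_le_self _ _ x) (by linarith [hq1 x])).trans hmod
  have hmod₂ : ∫⁻ x, f₂ x ^ q x ≤ 1 := (lintegral_mono fun x =>
    ENNReal.rpow_le_rpow (indicator_le_self _ _ x) (by linarith [hq1 x])).trans hmod
  have hadd : ∀ x, maximalFn f x ≤ maximalFn f₁ x + maximalFn f₂ x := by
    intro x
    have : f = fun y => f₁ y + f₂ y := (indicator_self_add_compl _ f).symm
    nth_rewrite 1 [this]
    exact maximalFn_add_le hf₁m _ x
  have h₁ : ∫⁻ x, maximalFn f₁ x ^ q x ≤ D ^ qm * K₁ := by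
    have h01 : ∀ x, f₁ x = 0 ∨ 1 ≤ f₁ x := by
      intro x
      by_cases hx : 1 < f x
      · right; simp [hf₁, indicator_of_mem (show x ∈ {x | 1 < f x} from hx), hx.le]
      · left; simp [hf₁, indicator_of_notMem (show x ∉ {x | 1 < f x} from hx)]
    calc ∫⁻ x, maximalFn f₁ x ^ q x
        ≤ ∫⁻ x, D ^ qm * maximalFn (fun y => f₁ y ^ (q y / qm)) x ^ qm := by
          refine lintegral_mono fun x => ?_
          have := ENNReal.rpow_le_rpow (hlarge f₁ hf₁m h01 hmod₁ x) hqm0.le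
          rwa [← ENNReal.rpow_mul, div_mul_cancel₀ _ hqm0.ne',
            ENNReal.mul_rpow_of_nonneg _ _ hqm0.le] at this
      _ = D ^ qm * ∫⁻ x, maximalFn (fun y => f₁ y ^ (q y / qm)) x ^ qm :=
          lintegral_const_mul _ ((measurable_maximalFn _).pow_const _)
      _ ≤ D ^ qm * (K₁ * ∫⁻ x, (f₁ x ^ (q x / qm)) ^ qm) := by
          gcongr
          exact hM₁ _ (hf₁m.pow (hqmeas.div_const _))
      _ ≤ D ^ qm * (K₁ * 1) := by
          gcongr
          simpa only [← ENNReal.rpow_mul, div_mul_cancel₀ _ hqm0.ne'] using hmod₁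
      _ = _ := by rw [mul_one]
  have hf₂1 : ∀ x, f₂ x ≤ 1 := by
    intro x
    by_cases hx : 1 < f x
    · simp [hf₂, hx]
    · simp [hf₂, hx, not_lt.1 hx]
  have hMf₂1 : ∀ x, maximalFn f₂ x ≤ 1 := fun x => maximalFn_le fun c r hr _ => by
    calc _ ≤ (volume (Metric.ball c r))⁻¹ * ∫⁻ _ in Metric.ball c r, 1 := by
          gcongr with y; exact hf₂1 y
      _ ≤ 1 := by rw [setLIntegral_one]; exact ENNReal.inv_mul_le_one _
  have h₂ : ∫⁻ x, maximalFn f₂ x ^ q x ≤ E * (K₂ * (E + ∫⁻ x, R x)) + ∫⁻ x, R x := by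
    have hback : ∫⁻ x, f₂ x ^ qinf ≤ E + ∫⁻ x, R x := by
      calc ∫⁻ x, f₂ x ^ qinf ≤ ∫⁻ x, (E * f₂ x ^ q x + R x) := lintegral_mono fun x =>
            rpow_le_mul_rpow_add (hf₂1 x) hqinf.le hC x (by rw [abs_sub_comm]; exact hinf x)
        _ = E * (∫⁻ x, f₂ x ^ q x) + ∫⁻ x, R x := by
            rw [lintegral_add_right _ hRm, lintegral_const_mul' _ _ hE']
        _ ≤ E * 1 + ∫⁻ x, R x := by gcongr
        _ = _ := by rw [mul_one]
    calc ∫⁻ x, maximalFn f₂ x ^ q x ≤ ∫⁻ x, (E * maximalFn f₂ x ^ qinf + R x) :=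
          lintegral_mono fun x => rpow_le_mul_rpow_add (hMf₂1 x) (hq1 x).le hC x (hinf x)
      _ = E * (∫⁻ x, maximalFn f₂ x ^ qinf) + ∫⁻ x, R x := by
          rw [lintegral_add_right _ hRm, lintegral_const_mul' _ _ hE']
      _ ≤ E * (K₂ * ∫⁻ x, f₂ x ^ qinf) + ∫⁻ x, R x := by
          gcongr
          exact hM₂ _ hf₂m
      _ ≤ _ := by gcongr
  calc ∫⁻ x, maximalFn f x ^ q x
      ≤ ∫⁻ x, 2 ^ (qp - 1) * (maximalFn f₁ x ^ q x + maximalFn f₂ x ^ q x) := by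
        refine lintegral_mono fun x => ?_
        refine (ENNReal.rpow_le_rpow (hadd x) (by linarith [hq1 x])).trans
          ((ENNReal.rpow_add_le_mul_rpow_add_rpow _ _ (hq1 x).le).trans ?_)
        exact mul_le_mul_left (two_rpow_mono (by linarith [(hq x).2])) _
    _ = 2 ^ (qp - 1) * ((∫⁻ x, maximalFn f₁ x ^ q x) + ∫⁻ x, maximalFn f₂ x ^ q x) := by
        rw [lintegral_const_mul' _ _ (two_rpow_ne_top _),
          lintegral_add_left ((measurable_maximalFn _).pow hqmeas)]
    _ ≤ _ := mul_le_mul_right (add_le_add h₁ h₂) _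

end

section

variable {n : ℕ} {q q' : Euc n → ℝ}

lemma div_log_lt_of_exp_lt {C ε t : ℝ} (hC : 0 ≤ C) (hε : 0 < ε) (ht : Real.exp (C / ε) < t) :
    C / Real.log (Real.exp 1 + t) < ε := by
  have ht0 : 0 < t := (Real.exp_pos _).trans ht
  have h1 : C / ε < Real.log (Real.exp 1 + t) := by
    rw [Real.lt_log_iff_exp_lt (by positivity)]
    linarith [Real.exp_pos 1]
  have h2 : 0 < Real.log (Real.exp 1 + t) := lt_of_le_of_lt (by positivity) h1
  rwa [div_lt_comm₀ h2 hε]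

lemma continuous_of_logHolder {C : ℝ} (hC : 0 ≤ C)
    (hlog : ∀ x y : Euc n, x ≠ y → |q x - q y| ≤ C / Real.log (Real.exp 1 + 1 / dist x y)) :
    Continuous q := by
  refine Metric.continuous_iff.2 fun x ε hε => ⟨(Real.exp (C / ε))⁻¹, by positivity, ?_⟩
  intro y hy
  rcases eq_or_ne y x with rfl | hxy
  · simpa using hε
  rw [Real.dist_eq]
  refine (hlog y x hxy).trans_lt (div_log_lt_of_exp_lt hC hε ?_)
  rw [one_div]
  exact (lt_inv_comm₀ (Real.exp_pos _) (dist_pos.2 hxy)).2 hy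

lemma bounds_of_ae_bounds {qm qp : ℝ} (hcont : Continuous q)
    (h : ∀ᵐ x ∂(volume : Measure (Euc n)), qm ≤ q x ∧ q x ≤ qp) (x : Euc n) :
    qm ≤ q x ∧ q x ≤ qp := by
  have hclosed : IsClosed {x | qm ≤ q x ∧ q x ≤ qp} :=
    (isClosed_le continuous_const hcont).inter (isClosed_le hcont continuous_const)
  have hdense : Dense {x | qm ≤ q x ∧ q x ≤ qp} := Measure.dense_of_ae h
  have := hdense.closure_eq
  rw [hclosed.closure_eq] at this
  exact (Set.ext_iff.1 this x).2 trivial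

lemma le_of_decay_at_infinity (hn : 0 < n) {qm qinf C : ℝ} (hC : 0 ≤ C) (hq : ∀ x, qm ≤ q x)
    (hinf : ∀ x : Euc n, |q x - qinf| ≤ C / Real.log (Real.exp 1 + ‖x‖)) : qm ≤ qinf := by
  by_contra! hlt
  have : Nonempty (Fin n) := ⟨⟨0, hn⟩⟩
  obtain ⟨x, hx⟩ := NormedSpace.exists_lt_norm ℝ (Euc n) (Real.exp (C / (qm - qinf)))
  have h1 := div_log_lt_of_exp_lt hC (sub_pos.2 hlt) hx
  linarith [hinf x, le_abs_self (q x - qinf), hq x]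

/-- Boundedness of the maximal operator on `L^{q(·)}` for log-Hölder continuous `q(·)`. -/
theorem exists_varNorm_maximalFn_le (hn : 0 < n) {qm qp : ℝ} (hqm : 1 < qm)
    (hq : ∀ x, qm ≤ q x ∧ q x ≤ qp) (hqmeas : Measurable q) (hlog : LogHolder q) :
    ∃ K : ℝ≥0∞, K ≠ 0 ∧ K ≠ ∞ ∧ ∀ f : Euc n → ℝ≥0∞, Measurable f →
      varNorm q (maximalFn f) ≤ K * varNorm q f := by
  obtain ⟨C, hC, qinf, hloc, hinf⟩ := hlog
  obtain ⟨K, hK1, hK, hmod⟩ := exists_lintegral_maximalFn_rpow_exponent_le hqm hq hqmeas hC.le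
    hloc hinf (hqm.trans_le (le_of_decay_at_infinity hn hC.le (fun x => (hq x).1) hinf))
  have hK0 : K ≠ 0 := (zero_lt_one.trans_le hK1).ne'
  refine ⟨K, hK0, hK, fun f hf => le_mul_varNorm hK0 hK fun lam h0 h1 h2 => ?_⟩
  refine varNorm_le (ENNReal.mul_pos hK0 h0.ne') (ENNReal.mul_ne_top hK h1)
    (lintegral_div_mul_rpow_le_one (fun x => hqm.le.trans (hq x).1) hK1 hK ?_)
  have h3 := hmod (fun x => f x / lam) (hf.div_const _) h2
  simp only [div_eq_mul_inv, mul_comm _ lam⁻¹] at h3 ⊢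
  simpa only [maximalFn_const_mul hf] using h3

/-- Boundedness of the maximal operator forces `‖χ_B‖_{q(·)} ‖χ_B‖_{q'(·)} ≲ |B|`. -/
lemma varNorm_ball_mul_varNorm_ball_le (hqq' : ∀ x, (q x).HolderConjugate (q' x))
    (hq'm : Measurable q') {Q : ℝ} (hQ : ∀ x, q' x ≤ Q) {K : ℝ≥0∞}
    (hM : ∀ f : Euc n → ℝ≥0∞, Measurable f → varNorm q (maximalFn f) ≤ K * varNorm q f)
    (c : Euc n) {r : ℝ} (hr : 0 < r) :
    varNorm q ((Metric.ball c r).indicator 1) * varNorm q' ((Metric.ball c r).indicator 1) ≤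
      2 ^ Q * K * volume (Metric.ball c r) := by
  set B := Metric.ball c r with hB
  have hB0 : volume B ≠ 0 := volume_ball_ne_zero c hr
  have hB1 : volume B ≠ ∞ := volume_ball_ne_top c r
  have hq0 : ∀ x, 0 < q x := fun x => (hqq' x).pos
  have hq'0 : ∀ x, 0 < q' x := fun x => (hqq' x).symm.pos
  have hq'1 : ∀ x, 1 ≤ q' x := fun x => (hqq' x).symm.lt.le
  set μ := varNorm q' (B.indicator 1) with hμ
  have hμ0 : μ ≠ 0 := varNorm_indicator_ne_zero hq'1 measurableSet_ball hB0
  have hμ1 : μ ≠ ∞ := varNorm_indicator_ne_top hq'1 hB1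
  obtain ⟨lam, h0, hlt, h1, hmod⟩ := exists_of_varNorm_lt
    (show varNorm q' (B.indicator 1) < 2 * μ by
      simpa [two_mul] using ENNReal.lt_add_right hμ1 hμ0)
  have hle : μ ≤ lam := varNorm_le h0 h1 hmod
  set I := ∫⁻ x, (B.indicator 1 x / lam) ^ q' x with hI
  have hI' : 1 ≤ 2 ^ Q * I := by
    by_contra! hcon
    have hhalf : μ ≤ lam / 2 := by
      refine varNorm_le (ENNReal.half_pos h0.ne') (ENNReal.div_ne_top h1 two_ne_zero)
        (le_trans ?_ hcon.le)
      rw [hI, ← lintegral_const_mul' _ _ (two_rpow_ne_top _)]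
      refine lintegral_mono fun x => ?_
      have e : B.indicator 1 x / (lam / 2) = 2 * (B.indicator 1 x / lam) := by
        rw [div_eq_mul_inv, ENNReal.inv_div (.inl ENNReal.ofNat_ne_top) (.inl two_ne_zero),
          div_eq_mul_inv, div_eq_mul_inv]
        ring
      simp only
      rw [e, ENNReal.mul_rpow_of_nonneg _ _ (hq'0 x).le]
      exact mul_le_mul_left (two_rpow_mono (hQ x)) _
    have : 2 * μ ≤ lam := by
      calc 2 * μ ≤ 2 * (lam / 2) := by gcongr
        _ = lam := ENNReal.mul_div_cancel two_ne_zero ENNReal.ofNat_ne_top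
    exact absurd hlt (not_lt.2 this)
  set f : Euc n → ℝ≥0∞ := B.indicator fun x => lam⁻¹ ^ (q' x - 1) with hf
  have hfm : Measurable f :=
    (measurable_const.pow (hq'm.sub_const 1)).indicator measurableSet_ball
  have hfq : ∀ x, f x ^ q x = (B.indicator 1 x / lam) ^ q' x := by
    intro x
    by_cases hx : x ∈ B
    · simp only [hf, indicator_of_mem hx, Pi.one_apply, one_div]
      rw [← ENNReal.rpow_mul]
      congr 1
      have := (hqq' x).mul_eq_add
      linarith
    · simp [hf, indicator_of_notMem hx, ENNReal.zero_rpow_of_pos (hq0 x),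
        ENNReal.zero_rpow_of_pos (hq'0 x)]
  have hfnorm : varNorm q f ≤ 1 := by
    refine varNorm_le one_pos one_ne_top ?_
    simpa only [div_one, hfq] using hmod
  have hpt : ∀ x ∈ B, f x = lam * (B.indicator 1 x / lam) ^ q' x := by
    intro x hx
    simp only [hf, indicator_of_mem hx, Pi.one_apply, one_div]
    have hi0 : lam⁻¹ ≠ 0 := ENNReal.inv_ne_zero.2 h1
    have hi1 : lam⁻¹ ≠ ∞ := ENNReal.inv_ne_top.2 h0.ne'
    nth_rewrite 2 [show q' x = 1 + (q' x - 1) by ring]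
    rw [ENNReal.rpow_add _ _ hi0 hi1, ENNReal.rpow_one, ← mul_assoc,
      ENNReal.mul_inv_cancel h0.ne' h1, one_mul]
  have hint : ∫⁻ x in B, f x = lam * I := by
    rw [hI, ← lintegral_const_mul' _ _ h1, setLIntegral_congr_fun measurableSet_ball hpt,
      setLIntegral_eq_of_support_subset]
    intro x hx
    by_contra h
    rw [← hB] at h
    simp [indicator_of_notMem h, ENNReal.zero_rpow_of_pos (hq'0 x)] at hx
  set a := (volume B)⁻¹ * (lam * I) with ha
  have hI0 : I ≠ 0 := by
    intro h
    simp [h] at hI'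
  have hI1 : I ≠ ∞ := (hmod.trans_lt one_lt_top).ne
  have ha0 : a ≠ 0 := mul_ne_zero (ENNReal.inv_ne_zero.2 hB1) (mul_ne_zero h0.ne' hI0)
  have ha1 : a ≠ ∞ :=
    ENNReal.mul_ne_top (ENNReal.inv_ne_top.2 hB0) (ENNReal.mul_ne_top h1 hI1)
  have hMf : varNorm q (fun x => a * B.indicator 1 x) ≤ K := by
    refine le_trans (varNorm_mono (fun x => (hq0 x).le) fun x => ?_)
      ((hM f hfm).trans ((mul_le_mul_right hfnorm K).trans_eq (mul_one K)))
    by_cases hx : x ∈ B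
    · simp only [indicator_of_mem hx, Pi.one_apply, mul_one]
      rw [ha, ← hint]
      exact average_le_maximalFn f hr hx
    · simp [hx]
  have hχ : a * varNorm q (B.indicator 1) ≤ K := by
    have h3 := varNorm_const_mul_le_of_ne (q := q) (f := fun x => a * B.indicator 1 x)
      (ENNReal.inv_ne_zero.2 ha1) (ENNReal.inv_ne_top.2 ha0)
    simp only [← mul_assoc, ENNReal.inv_mul_cancel ha0 ha1, one_mul] at h3
    calc a * varNorm q (B.indicator 1) ≤ a * (a⁻¹ * K) := by
          gcongr
          exact h3.trans (mul_le_mul_right hMf _)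
      _ = K := by rw [← mul_assoc, ENNReal.mul_inv_cancel ha0 ha1, one_mul]
  calc varNorm q (B.indicator 1) * μ ≤ varNorm q (B.indicator 1) * (lam * (2 ^ Q * I)) := by
        gcongr
        exact hle.trans (le_mul_of_one_le_right' hI')
    _ = 2 ^ Q * (volume B * a * varNorm q (B.indicator 1)) := by
        rw [ha, ← mul_assoc (volume B), ENNReal.mul_inv_cancel hB0 hB1, one_mul]
        ring
    _ ≤ 2 ^ Q * (volume B * K) := by
        rw [mul_assoc (volume B)]
        gcongr
    _ = _ := by ring

end

section

variable {n : ℕ} {q q' : Euc n → ℝ} {f : Euc n → ℝ≥0∞}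

lemma measurableSet_annulus (k : ℤ) : MeasurableSet (annulus n k) :=
  measurableSet_ball.diff measurableSet_ball

lemma mem_annulus_iff {k : ℤ} {x : Euc n} :
    x ∈ annulus n k ↔ (2 : ℝ) ^ (k - 1) ≤ ‖x‖ ∧ ‖x‖ < 2 ^ k := by
  simp [annulus, and_comm]

lemma exists_mem_annulus {x : Euc n} (hx : x ≠ 0) : ∃ k, x ∈ annulus n k := by
  obtain ⟨k, h1, h2⟩ := exists_mem_Ico_zpow (norm_pos_iff.2 hx) one_lt_two
  exact ⟨k + 1, mem_annulus_iff.2 ⟨by simpa using h1, h2⟩⟩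

lemma volume_annulus_ne_zero (hn : 0 < n) (k : ℤ) : volume (annulus n k) ≠ 0 := by
  have h2 : (0 : ℝ) < 2 ^ (k - 1) := by positivity
  have hk : (2 : ℝ) ^ k = 2 * 2 ^ (k - 1) := by
    rw [← zpow_one_add₀ two_ne_zero]
    congr 1
    ring
  have hlt : volume (Metric.ball (0 : Euc n) ((2 : ℝ) ^ (k - 1))) <
      volume (Metric.ball (0 : Euc n) ((2 : ℝ) ^ k)) := by
    rw [volume_ball_eq _ h2, volume_ball_eq _ (by positivity : (0 : ℝ) < 2 ^ k)]
    refine ENNReal.mul_lt_mul_left (volume_ball_ne_zero _ one_pos) (volume_ball_ne_top _ _) ?_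
    rw [ENNReal.ofReal_lt_ofReal_iff (by positivity)]
    exact pow_lt_pow_left₀ (by linarith) h2.le hn.ne'
  intro h
  have := le_measure_sdiff (μ := volume) (s₁ := Metric.ball (0 : Euc n) ((2 : ℝ) ^ k))
    (s₂ := Metric.ball (0 : Euc n) ((2 : ℝ) ^ (k - 1)))
  change _ ≤ volume (annulus n k) at this
  rw [h, nonpos_iff_eq_zero, tsub_eq_zero_iff_le] at this
  exact absurd hlt (not_lt.2 this)

lemma volume_ball_two_zpow (k : ℤ) :
    volume (Metric.ball (0 : Euc n) ((2 : ℝ) ^ k)) =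
      (2 : ℝ≥0∞) ^ ((n : ℝ) * k) * volume (Metric.ball (0 : Euc n) 1) := by
  rw [volume_ball_eq _ (by positivity)]
  congr 1
  rw [mul_comm, ENNReal.rpow_mul, ENNReal.rpow_natCast, ENNReal.ofReal_pow (by positivity),
    ← Real.rpow_intCast, ← ENNReal.ofReal_rpow_of_pos two_pos, ENNReal.ofReal_ofNat]

lemma volume_ball_le_of_le_eight_mul (c : Euc n) {r s : ℝ} (hs : 0 < s) (h : s ≤ 8 * r) :
    volume (Metric.ball (0 : Euc n) s) ≤ 8 ^ n * volume (Metric.ball c r) := by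
  have hr : 0 < r := by linarith
  rw [volume_ball_eq _ hs, volume_ball_eq _ hr, ← mul_assoc]
  refine mul_le_mul_left ?_ _
  calc ENNReal.ofReal (s ^ n) ≤ ENNReal.ofReal ((8 * r) ^ n) := by gcongr
    _ = 8 ^ n * ENNReal.ofReal (r ^ n) := by
      rw [mul_pow, ENNReal.ofReal_mul (by positivity), ENNReal.ofReal_pow (by norm_num)]
      norm_num

lemma two_zpow_le_dist {j k : ℤ} (hjk : j + 2 ≤ k) {x y : Euc n} (hx : x ∈ annulus n k)
    (hy : y ∈ annulus n j) : (2 : ℝ) ^ k ≤ 4 * dist x y := by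
  have h1 := (mem_annulus_iff.1 hx).1
  have h2 := (mem_annulus_iff.1 hy).2
  have h3 : (2 : ℝ) ^ j ≤ 2 ^ (k - 2) := zpow_le_zpow_right₀ one_le_two (by lia)
  have e1 : (2 : ℝ) ^ (k - 1) = 2 ^ k / 2 := by rw [zpow_sub₀ two_ne_zero, zpow_one]
  have e2 : (2 : ℝ) ^ (k - 2) = 2 ^ k / 4 := by
    rw [zpow_sub₀ two_ne_zero]
    norm_num
  have h4 : ‖x‖ - ‖y‖ ≤ dist x y := by
    rw [dist_eq_norm]
    exact norm_sub_norm_le x y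
  linarith

lemma maximalFn_indicator_annulus_le {j k m : ℤ}
    (hm : j + 2 ≤ k ∧ m = k ∨ k + 2 ≤ j ∧ m = j) (f : Euc n → ℝ≥0∞) {x : Euc n}
    (hx : x ∈ annulus n k) :
    maximalFn ((annulus n j).indicator f) x ≤
      8 ^ n * ((volume (Metric.ball (0 : Euc n) ((2 : ℝ) ^ m)))⁻¹ * ∫⁻ y in annulus n j, f y) := by
  refine maximalFn_le fun c r hr hxB => ?_
  rcases (Metric.ball c r ∩ annulus n j).eq_empty_or_nonempty with h | ⟨y, hyB, hy⟩
  · have h0 : ∫⁻ y in Metric.ball c r, (annulus n j).indicator f y = 0 := by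
      rw [lintegral_indicator (measurableSet_annulus j),
        Measure.restrict_restrict (measurableSet_annulus j), inter_comm, h]
      simp
    simp [h0]
  have hd : dist x y ≤ 2 * r := by
    have h1 := Metric.mem_ball.1 hxB
    have h2 := Metric.mem_ball'.1 hyB
    linarith [dist_triangle x c y]
  have hr8 : (2 : ℝ) ^ m ≤ 8 * r := by
    rcases hm with ⟨h, rfl⟩ | ⟨h, rfl⟩
    · linarith [two_zpow_le_dist h hx hy]
    · linarith [two_zpow_le_dist h hy hx, dist_comm x y]
  have hv := volume_ball_le_of_le_eight_mul c (by positivity : (0 : ℝ) < 2 ^ m) hr8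
  have h8 : (8 ^ n : ℝ≥0∞) ≠ 0 := by positivity
  have h8' : (8 ^ n : ℝ≥0∞) ≠ ∞ := ENNReal.pow_ne_top ENNReal.ofNat_ne_top
  rw [← mul_assoc]
  refine mul_le_mul' ?_ ?_
  · have h3 := ENNReal.inv_le_inv.2 hv
    rw [ENNReal.mul_inv (.inl h8) (.inl h8')] at h3
    calc _ = 8 ^ n * ((8 ^ n)⁻¹ * (volume (Metric.ball c r))⁻¹) := by
          rw [← mul_assoc, ENNReal.mul_inv_cancel h8 h8', one_mul]
      _ ≤ _ := mul_le_mul_right h3 _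
  · rw [← lintegral_indicator (measurableSet_annulus j)]
    exact setLIntegral_le_lintegral _ _

lemma le_tsum_indicator_annulus (f : Euc n → ℝ≥0∞) (k : ℤ) {x : Euc n} (hx : x ≠ 0) :
    f x ≤ (annulus n (k - 1)).indicator f x + ((annulus n k).indicator f x +
      ((annulus n (k + 1)).indicator f x +
        ∑' j : ℤ, if 2 ≤ |j - k| then (annulus n j).indicator f x else 0)) := by
  obtain ⟨j, hj⟩ := exists_mem_annulus hx
  have hfj : (annulus n j).indicator f x = f x := indicator_of_mem hj f
  rcases lt_or_ge |j - k| 2 with h | h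
  · have : j = k - 1 ∨ j = k ∨ j = k + 1 := by
      rw [abs_lt] at h
      lia
    rcases this with rfl | rfl | rfl
    · rw [hfj]
      exact le_self_add
    · rw [hfj]
      exact le_add_left le_self_add
    · rw [hfj]
      exact le_add_left (le_add_left le_self_add)
  · refine le_add_left (le_add_left (le_add_left ?_))
    refine le_trans ?_ (ENNReal.le_tsum j)
    rw [if_pos h, hfj]

lemma varNorm_ball_le_of_dyadic (hq : ∀ x, 1 ≤ q x) {C : ℝ≥0∞} {δ : ℝ}
    (hdy : ∀ (x : Euc n) (r : ℝ), 0 < r → ∀ E : Set (Euc n), MeasurableSet E →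
      E ⊆ Metric.ball x r →
        varNorm q (E.indicator 1) / varNorm q ((Metric.ball x r).indicator 1)
          ≤ C * (volume E / volume (Metric.ball x r)) ^ δ) {j k : ℤ} (hjk : j ≤ k) :
    varNorm q ((Metric.ball (0 : Euc n) ((2 : ℝ) ^ j)).indicator 1) ≤
      C * (2 : ℝ≥0∞) ^ (((j : ℝ) - k) * (n * δ)) *
        varNorm q ((Metric.ball (0 : Euc n) ((2 : ℝ) ^ k)).indicator 1) := by
  have hk : (0 : ℝ) < 2 ^ k := by positivity
  have h := hdy 0 (2 ^ k) hk (Metric.ball 0 (2 ^ j)) measurableSet_ball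
    (Metric.ball_subset_ball (zpow_le_zpow_right₀ one_le_two hjk))
  rw [ENNReal.div_le_iff
    (varNorm_indicator_ne_zero hq measurableSet_ball (volume_ball_ne_zero _ hk))
    (varNorm_indicator_ne_top hq (volume_ball_ne_top _ _))] at h
  convert h using 3
  rw [volume_ball_two_zpow, volume_ball_two_zpow,
    ENNReal.mul_div_mul_right _ _ (volume_ball_ne_zero _ one_pos) (volume_ball_ne_top _ _),
    ← ENNReal.rpow_sub _ _ two_ne_zero ENNReal.ofNat_ne_top, ← ENNReal.rpow_mul]
  congr 1
  ring

end

section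

variable {n : ℕ} {q q' : Euc n → ℝ} {f : Euc n → ℝ≥0∞}

lemma tsum_rpow_decay_le {p : ℝ} (ε : ℝ) (hp : 0 < p) (b : ℤ → ℝ≥0∞) :
    ∑' k : ℤ, (∑' j : ℤ, (2 : ℝ≥0∞) ^ (-(ε * |((j - k : ℤ) : ℝ)|)) * b j) ^ p ≤
      decaySum (ε / 2) ^ p * decaySum (ε / 2 * p) * ∑' j : ℤ, b j ^ p := by
  have hshift : ∀ (η : ℝ) (k : ℤ),
      ∑' j : ℤ, (2 : ℝ≥0∞) ^ (-(η * |((j - k : ℤ) : ℝ)|)) = decaySum η := fun η k =>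
    (Equiv.subRight k).tsum_eq fun i : ℤ => (2 : ℝ≥0∞) ^ (-(η * |(i : ℝ)|))
  have hsup : ∀ k : ℤ, (∑' j : ℤ, (2 : ℝ≥0∞) ^ (-(ε * |((j - k : ℤ) : ℝ)|)) * b j) ^ p ≤
      decaySum (ε / 2) ^ p *
        ∑' j : ℤ, (2 : ℝ≥0∞) ^ (-(ε / 2 * p * |((j - k : ℤ) : ℝ)|)) * b j ^ p := by
    intro k
    set T := ∑' j : ℤ, (2 : ℝ≥0∞) ^ (-(ε / 2 * p * |((j - k : ℤ) : ℝ)|)) * b j ^ p with hT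
    have hj : ∀ j : ℤ, (2 : ℝ≥0∞) ^ (-(ε / 2 * |((j - k : ℤ) : ℝ)|)) * b j ≤ T ^ (1 / p) := by
      intro j
      rw [one_div, ENNReal.le_rpow_inv_iff hp, ENNReal.mul_rpow_of_nonneg _ _ hp.le,
        ← ENNReal.rpow_mul]
      refine le_trans (le_of_eq ?_) (ENNReal.le_tsum j)
      congr 2
      ring
    have hsum : ∑' j : ℤ, (2 : ℝ≥0∞) ^ (-(ε * |((j - k : ℤ) : ℝ)|)) * b j ≤
        decaySum (ε / 2) * T ^ (1 / p) := by
      rw [← hshift (ε / 2) k, ← ENNReal.tsum_mul_right]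
      refine ENNReal.tsum_le_tsum fun j => ?_
      rw [show -(ε * |((j - k : ℤ) : ℝ)|) = -(ε / 2 * |((j - k : ℤ) : ℝ)|) +
        -(ε / 2 * |((j - k : ℤ) : ℝ)|) by ring, two_rpow_add, mul_assoc]
      exact mul_le_mul_right (hj j) _
    refine (ENNReal.rpow_le_rpow hsum hp.le).trans_eq ?_
    rw [ENNReal.mul_rpow_of_nonneg _ _ hp.le, ← ENNReal.rpow_mul, one_div_mul_cancel hp.ne',
      ENNReal.rpow_one]
  refine (ENNReal.tsum_le_tsum hsup).trans_eq ?_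
  rw [ENNReal.tsum_mul_left, ENNReal.tsum_comm, mul_assoc,
    ← ENNReal.tsum_mul_left (a := decaySum (ε / 2 * p))]
  refine congrArg (decaySum (ε / 2) ^ p * ·) (tsum_congr fun j => ?_)
  rw [ENNReal.tsum_mul_right, ← hshift (ε / 2 * p) j]
  refine congrArg (· * b j ^ p) (tsum_congr fun k => ?_)
  rw [← abs_neg]
  congr 4
  push_cast
  ring

lemma varNorm_annulus_mul_lintegral_le (hqm : Measurable q)
    (hqq' : ∀ x, (q x).HolderConjugate (q' x)) {δ₁ δ₂ : ℝ} {C K' : ℝ≥0∞}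
    (hdy₁ : ∀ (x : Euc n) (r : ℝ), 0 < r → ∀ E : Set (Euc n), MeasurableSet E →
      E ⊆ Metric.ball x r →
        varNorm q (E.indicator 1) / varNorm q ((Metric.ball x r).indicator 1)
          ≤ C * (volume E / volume (Metric.ball x r)) ^ δ₁)
    (hdy₂ : ∀ (x : Euc n) (r : ℝ), 0 < r → ∀ E : Set (Euc n), MeasurableSet E →
      E ⊆ Metric.ball x r →
        varNorm q' (E.indicator 1) / varNorm q' ((Metric.ball x r).indicator 1)
          ≤ C * (volume E / volume (Metric.ball x r)) ^ δ₂)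
    (hK' : ∀ (c : Euc n) (r : ℝ), 0 < r → varNorm q ((Metric.ball c r).indicator 1) *
      varNorm q' ((Metric.ball c r).indicator 1) ≤ K' * volume (Metric.ball c r))
    (hf : Measurable f) {j k m : ℤ} {s : ℝ}
    (hm : j + 2 ≤ k ∧ m = k ∧ s = (j - k) * (n * δ₂) ∨
      k + 2 ≤ j ∧ m = j ∧ s = (k - j) * (n * δ₁)) :
    varNorm q ((annulus n k).indicator 1) *
        ((volume (Metric.ball (0 : Euc n) ((2 : ℝ) ^ m)))⁻¹ * ∫⁻ y in annulus n j, f y) ≤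
      2 * C * K' * 2 ^ s * varNorm q ((annulus n j).indicator f) := by
  have hq1 : ∀ x, 1 ≤ q x := fun x => (hqq' x).lt.le
  have hq'1 : ∀ x, 1 ≤ q' x := fun x => (hqq' x).symm.lt.le
  set B : ℤ → Set (Euc n) := fun i => Metric.ball (0 : Euc n) ((2 : ℝ) ^ i) with hB
  have hpos : ∀ i : ℤ, (0 : ℝ) < 2 ^ i := fun i => by positivity
  have hB0 : ∀ i, volume (B i) ≠ 0 := fun i => volume_ball_ne_zero _ (hpos i)
  have hB1 : ∀ i, volume (B i) ≠ ∞ := fun i => volume_ball_ne_top _ _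
  set F := varNorm q ((annulus n j).indicator f) with hF
  have hholder : ∫⁻ y in annulus n j, f y ≤ 2 * varNorm q' ((B j).indicator 1) * F := by
    have h := lintegral_mul_le_varNorm hqm hqq' (hf.indicator (measurableSet_annulus j))
      (varNorm_indicator_ne_zero hq'1 measurableSet_ball (hB0 j))
      (varNorm_indicator_ne_top hq'1 (hB1 j))
    refine le_trans (le_of_eq ?_) h
    rw [← lintegral_indicator (measurableSet_annulus j)]
    refine lintegral_congr fun x => ?_
    by_cases hx : x ∈ annulus n j
    · have hxB : x ∈ B j := hx.1
      rw [indicator_of_mem hxB, Pi.one_apply, mul_one]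
    · rw [indicator_of_notMem hx, zero_mul]
  have hann : varNorm q ((annulus n k).indicator 1) ≤ varNorm q ((B k).indicator 1) :=
    varNorm_mono (fun x => by linarith [hq1 x]) fun x =>
      indicator_le_indicator_of_subset sdiff_subset (fun _ => zero_le) x
  have hprod : varNorm q ((B k).indicator 1) * varNorm q' ((B j).indicator 1) ≤
      C * 2 ^ s * (K' * volume (B m)) := by
    rcases hm with ⟨h, rfl, rfl⟩ | ⟨h, rfl, rfl⟩
    · have h1 := varNorm_ball_le_of_dyadic hq'1 hdy₂ (show j ≤ m by lia)
      calc _ ≤ varNorm q ((B m).indicator 1) * _ := mul_le_mul_right h1 _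
        _ = C * 2 ^ (((j : ℝ) - m) * (n * δ₂)) *
            (varNorm q ((B m).indicator 1) * varNorm q' ((B m).indicator 1)) := by ring
        _ ≤ _ := mul_le_mul_right (hK' _ _ (hpos m)) _
    · have h1 := varNorm_ball_le_of_dyadic hq1 hdy₁ (show k ≤ m by lia)
      calc _ ≤ _ * varNorm q' ((B m).indicator 1) := mul_le_mul_left h1 _
        _ = C * 2 ^ (((k : ℝ) - m) * (n * δ₁)) *
            (varNorm q ((B m).indicator 1) * varNorm q' ((B m).indicator 1)) := by ring
        _ ≤ _ := mul_le_mul_right (hK' _ _ (hpos m)) _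
  calc _ ≤ varNorm q ((B k).indicator 1) *
        ((volume (B m))⁻¹ * (2 * varNorm q' ((B j).indicator 1) * F)) :=
        mul_le_mul' hann (mul_le_mul_right hholder _)
    _ = 2 * (volume (B m))⁻¹ * F *
        (varNorm q ((B k).indicator 1) * varNorm q' ((B j).indicator 1)) := by ring
    _ ≤ 2 * (volume (B m))⁻¹ * F * (C * 2 ^ s * (K' * volume (B m))) := mul_le_mul_right hprod _
    _ = 2 * C * K' * 2 ^ s * F * ((volume (B m))⁻¹ * volume (B m)) := by ring
    _ = _ := by rw [ENNReal.inv_mul_cancel (hB0 m) (hB1 m), mul_one]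

end

section

variable {n : ℕ} {q q' : Euc n → ℝ} {f : Euc n → ℝ≥0∞}

lemma maximalFn_le_on_annulus (hn : 0 < n) (hf : Measurable f) {k : ℤ} {x : Euc n}
    (hx : x ∈ annulus n k) :
    maximalFn f x ≤ maximalFn ((annulus n (k - 1)).indicator f) x +
      (maximalFn ((annulus n k).indicator f) x +
        (maximalFn ((annulus n (k + 1)).indicator f) x +
          ∑' j : ℤ, if 2 ≤ |j - k| then
            8 ^ n * ((volume (Metric.ball (0 : Euc n) ((2 : ℝ) ^ max j k)))⁻¹ *
              ∫⁻ y in annulus n j, f y) else 0)) := by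
  have : Nonempty (Fin n) := ⟨⟨0, hn⟩⟩
  have hfm : ∀ j : ℤ, Measurable ((annulus n j).indicator f) := fun j =>
    hf.indicator (measurableSet_annulus j)
  refine (maximalFn_mono_ae ((Measure.ae_ne volume (0 : Euc n)).mono fun y hy =>
    le_tsum_indicator_annulus f k hy) x).trans ?_
  refine (maximalFn_add_le (hfm _) _ x).trans (add_le_add_right ?_ _)
  refine (maximalFn_add_le (hfm _) _ x).trans (add_le_add_right ?_ _)
  refine (maximalFn_add_le (hfm _) _ x).trans (add_le_add_right ?_ _)
  refine (maximalFn_tsum_le (fun j => ?_) x).trans (ENNReal.tsum_le_tsum fun j => ?_)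
  · split_ifs
    exacts [hfm j, measurable_const]
  · split_ifs with h
    · refine maximalFn_indicator_annulus_le ?_ f hx
      rcases le_abs.1 h with h | h
      · exact .inr ⟨by lia, max_eq_left (by lia)⟩
      · exact .inl ⟨by lia, max_eq_right (by lia)⟩
    · exact maximalFn_le fun c r _ _ => by simp

lemma varNorm_annulus_maximalFn_le (hn : 0 < n) (hqm : Measurable q)
    (hqq' : ∀ x, (q x).HolderConjugate (q' x)) {δ₁ δ₂ α ε : ℝ} {C K K' : ℝ≥0∞}
    (hM : ∀ f : Euc n → ℝ≥0∞, Measurable f → varNorm q (maximalFn f) ≤ K * varNorm q f)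
    (hdy₁ : ∀ (x : Euc n) (r : ℝ), 0 < r → ∀ E : Set (Euc n), MeasurableSet E →
      E ⊆ Metric.ball x r →
        varNorm q (E.indicator 1) / varNorm q ((Metric.ball x r).indicator 1)
          ≤ C * (volume E / volume (Metric.ball x r)) ^ δ₁)
    (hdy₂ : ∀ (x : Euc n) (r : ℝ), 0 < r → ∀ E : Set (Euc n), MeasurableSet E →
      E ⊆ Metric.ball x r →
        varNorm q' (E.indicator 1) / varNorm q' ((Metric.ball x r).indicator 1)
          ≤ C * (volume E / volume (Metric.ball x r)) ^ δ₂)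
    (hK' : ∀ (c : Euc n) (r : ℝ), 0 < r → varNorm q ((Metric.ball c r).indicator 1) *
      varNorm q' ((Metric.ball c r).indicator 1) ≤ K' * volume (Metric.ball c r))
    (hε : 0 < ε) (hε₁ : ε ≤ α + n * δ₁) (hε₂ : ε ≤ n * δ₂ - α)
    (hf : Measurable f) (k : ℤ) :
    (2 : ℝ≥0∞) ^ ((k : ℝ) * α) * varNorm q ((annulus n k).indicator (maximalFn f)) ≤
      64 * (3 * (K * 2 ^ (|α| + ε)) + 8 ^ n * (2 * C * K')) *
        ∑' j : ℤ, (2 : ℝ≥0∞) ^ (-(ε * |((j - k : ℤ) : ℝ)|)) *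
          ((2 : ℝ≥0∞) ^ ((j : ℝ) * α) * varNorm q ((annulus n j).indicator f)) := by
  have hq1 : ∀ x, 1 ≤ q x := fun x => (hqq' x).lt.le
  have hq0 : ∀ x, 0 < q x := fun x => (hqq' x).pos
  set F : ℤ → ℝ≥0∞ := fun j => varNorm q ((annulus n j).indicator f) with hF
  set S := ∑' j : ℤ, (2 : ℝ≥0∞) ^ (-(ε * |((j - k : ℤ) : ℝ)|)) *
    ((2 : ℝ≥0∞) ^ ((j : ℝ) * α) * F j) with hS
  set c : ℤ → ℝ≥0∞ := fun j => if 2 ≤ |j - k| then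
    8 ^ n * ((volume (Metric.ball (0 : Euc n) ((2 : ℝ) ^ max j k)))⁻¹ *
      ∫⁻ y in annulus n j, f y) else 0 with hc
  set χ := varNorm q ((annulus n k).indicator 1) with hχ
  have hχ0 : χ ≠ 0 :=
    varNorm_indicator_ne_zero hq1 (measurableSet_annulus k) (volume_annulus_ne_zero hn k)
  have hnear : ∀ j : ℤ, |j - k| ≤ 1 → (2 : ℝ≥0∞) ^ ((k : ℝ) * α) * F j ≤ 2 ^ (|α| + ε) * S := by
    intro j hj
    have hj' : |((j - k : ℤ) : ℝ)| ≤ 1 := by exact_mod_cast hj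
    have hexp : (k : ℝ) * α ≤
        (|α| + ε) + (-(ε * |((j - k : ℤ) : ℝ)|) + (j : ℝ) * α) := by
      have h1 : -(((j - k : ℤ) : ℝ) * α) ≤ |α| := by
        refine (neg_le_abs _).trans ?_
        rw [abs_mul]
        exact mul_le_of_le_one_left (abs_nonneg α) hj'
      have h2 : ε * |((j - k : ℤ) : ℝ)| ≤ ε := mul_le_of_le_one_right hε.le hj'
      push_cast at h1 h2 ⊢
      linarith
    calc _ ≤ 2 ^ ((|α| + ε) + (-(ε * |((j - k : ℤ) : ℝ)|) + (j : ℝ) * α)) * F j :=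
          mul_le_mul_left (two_rpow_mono hexp) _
      _ = 2 ^ (|α| + ε) * (2 ^ (-(ε * |((j - k : ℤ) : ℝ)|)) * (2 ^ ((j : ℝ) * α) * F j)) := by
          rw [two_rpow_add (|α| + ε), two_rpow_add (-(ε * |((j - k : ℤ) : ℝ)|))]
          ring
      _ ≤ _ := mul_le_mul_right (ENNReal.le_tsum j) _
  have hfar : (2 : ℝ≥0∞) ^ ((k : ℝ) * α) * ((∑' j, c j) * χ) ≤ 8 ^ n * (2 * C * K') * S := by
    rw [← ENNReal.tsum_mul_right, ← ENNReal.tsum_mul_left, hS, ← ENNReal.tsum_mul_left]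
    refine ENNReal.tsum_le_tsum fun j => ?_
    simp only [hc]
    split_ifs with h
    swap
    · simp
    have hs : ∃ s : ℝ, (j + 2 ≤ k ∧ max j k = k ∧ s = (j - k) * (n * δ₂) ∨
        k + 2 ≤ j ∧ max j k = j ∧ s = (k - j) * (n * δ₁)) ∧
        (k : ℝ) * α + s ≤ -(ε * |((j - k : ℤ) : ℝ)|) + (j : ℝ) * α := by
      rcases le_abs.1 h with h | h
      · refine ⟨_, .inr ⟨by lia, max_eq_left (by lia), rfl⟩, ?_⟩
        have h0 : (0 : ℝ) ≤ ((j - k : ℤ) : ℝ) := by exact_mod_cast (by lia : 0 ≤ j - k)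
        rw [abs_of_nonneg h0]
        have := mul_le_mul_of_nonneg_right hε₁ h0
        push_cast at this ⊢
        linarith
      · refine ⟨_, .inl ⟨by lia, max_eq_right (by lia), rfl⟩, ?_⟩
        have h0 : ((j - k : ℤ) : ℝ) ≤ 0 := by exact_mod_cast (by lia : j - k ≤ 0)
        rw [abs_of_nonpos h0]
        have := mul_le_mul_of_nonneg_right hε₂ (neg_nonneg.2 h0)
        push_cast at this ⊢
        linarith
    obtain ⟨s, hs, hexp⟩ := hs
    have hj := varNorm_annulus_mul_lintegral_le hqm hqq' hdy₁ hdy₂ hK' hf hs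
    calc _ = 2 ^ ((k : ℝ) * α) * 8 ^ n * (χ *
          ((volume (Metric.ball (0 : Euc n) ((2 : ℝ) ^ max j k)))⁻¹ *
            ∫⁻ y in annulus n j, f y)) := by ring
      _ ≤ 2 ^ ((k : ℝ) * α) * 8 ^ n * (2 * C * K' * 2 ^ s * F j) := mul_le_mul_right hj _
      _ = 8 ^ n * (2 * C * K') * (2 ^ ((k : ℝ) * α + s) * F j) := by
          rw [two_rpow_add]
          ring
      _ ≤ 8 ^ n * (2 * C * K') *
          (2 ^ (-(ε * |((j - k : ℤ) : ℝ)|) + (j : ℝ) * α) * F j) :=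
          mul_le_mul_right (mul_le_mul_left (two_rpow_mono hexp) _) _
      _ = _ := by
          rw [two_rpow_add]
          ring
  have hsplit : varNorm q ((annulus n k).indicator (maximalFn f)) ≤
      4 * (K * F (k - 1) + 4 * (K * F k + 4 * (K * F (k + 1) + (∑' j, c j) * χ))) := by
    have hmax : ∀ j : ℤ, varNorm q (maximalFn ((annulus n j).indicator f)) ≤ K * F j := fun j =>
      hM _ (hf.indicator (measurableSet_annulus j))
    refine (varNorm_mono (g := fun x => maximalFn ((annulus n (k - 1)).indicator f) x +
      (maximalFn ((annulus n k).indicator f) x +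
        (maximalFn ((annulus n (k + 1)).indicator f) x +
          (∑' j, c j) * (annulus n k).indicator 1 x))) (fun x => (hq0 x).le) fun x => ?_).trans ?_
    · by_cases hx : x ∈ annulus n k
      · rw [indicator_of_mem hx, indicator_of_mem hx, Pi.one_apply, mul_one]
        exact maximalFn_le_on_annulus hn hf hx
      · rw [indicator_of_notMem hx]
        exact zero_le
    · refine (varNorm_add_le hqm hq1 (measurable_maximalFn _)).trans
        (mul_le_mul_right (add_le_add (hmax _) ?_) _)
      refine (varNorm_add_le hqm hq1 (measurable_maximalFn _)).trans
        (mul_le_mul_right (add_le_add (hmax _) ?_) _)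
      refine (varNorm_add_le hqm hq1 (measurable_maximalFn _)).trans
        (mul_le_mul_right (add_le_add (hmax _) ?_) _)
      exact varNorm_const_mul_le hq0 hχ0
  have hcoarse : ∀ a b c d : ℝ≥0∞, 4 * (a + 4 * (b + 4 * (c + d))) ≤ 64 * (a + b + c + d) := by
    intro a b c d
    calc 4 * (a + 4 * (b + 4 * (c + d))) = 4 * a + 16 * b + 64 * c + 64 * d := by ring
      _ ≤ 64 * a + 64 * b + 64 * c + 64 * d := by gcongr <;> norm_num
      _ = _ := by ring
  calc _ ≤ 2 ^ ((k : ℝ) * α) *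
        (64 * (K * F (k - 1) + K * F k + K * F (k + 1) + (∑' j, c j) * χ)) :=
        mul_le_mul_right (hsplit.trans (hcoarse _ _ _ _)) _
    _ = 64 * (K * (2 ^ ((k : ℝ) * α) * F (k - 1)) + K * (2 ^ ((k : ℝ) * α) * F k) +
        K * (2 ^ ((k : ℝ) * α) * F (k + 1)) + 2 ^ ((k : ℝ) * α) * ((∑' j, c j) * χ)) := by ring
    _ ≤ 64 * (K * (2 ^ (|α| + ε) * S) + K * (2 ^ (|α| + ε) * S) + K * (2 ^ (|α| + ε) * S) +
        8 ^ n * (2 * C * K') * S) :=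
        mul_le_mul_right (add_le_add (add_le_add (add_le_add
          (mul_le_mul_right (hnear _ (by simp)) _) (mul_le_mul_right (hnear _ (by simp)) _))
          (mul_le_mul_right (hnear _ (by simp)) _)) hfar) _
    _ = _ := by ring

end

section

variable {n : ℕ} {q : Euc n → ℝ} {f : Euc n → ℝ≥0∞} {N : (Euc n → ℝ≥0∞) → ℝ≥0∞} {α p : ℝ}

lemma two_rpow_mul_rpow_eq (hp : 0 < p) (k : ℤ) (a : ℝ≥0∞) :
    (2 : ℝ≥0∞) ^ ((k : ℝ) * p * α) * a ^ p = (2 ^ ((k : ℝ) * α) * a) ^ p := by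
  rw [ENNReal.mul_rpow_of_nonneg _ _ hp.le, ← ENNReal.rpow_mul]
  congr 2
  ring

lemma herzNorm_le_of_decay (hp : 0 < p) {ε : ℝ} {D : ℝ≥0∞} {g : Euc n → ℝ≥0∞}
    (h : ∀ k : ℤ, (2 : ℝ≥0∞) ^ ((k : ℝ) * α) * N ((annulus n k).indicator g) ≤
      D * ∑' j : ℤ, (2 : ℝ≥0∞) ^ (-(ε * |((j - k : ℤ) : ℝ)|)) *
        ((2 : ℝ≥0∞) ^ ((j : ℝ) * α) * N ((annulus n j).indicator f))) :
    herzNorm N α p g ≤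
      D * (decaySum (ε / 2) ^ p * decaySum (ε / 2 * p)) ^ (1 / p) * herzNorm N α p f := by
  have hp' : 0 ≤ 1 / p := by positivity
  have hD : (D ^ p) ^ (1 / p) = D := by
    rw [← ENNReal.rpow_mul, mul_one_div_cancel hp.ne', ENNReal.rpow_one]
  simp only [herzNorm, two_rpow_mul_rpow_eq hp]
  nth_rewrite 1 [← hD]
  rw [← ENNReal.mul_rpow_of_nonneg _ _ hp', ← ENNReal.mul_rpow_of_nonneg _ _ hp', mul_assoc]
  refine ENNReal.rpow_le_rpow ?_ hp'
  refine (ENNReal.tsum_le_tsum fun k => ENNReal.rpow_le_rpow (h k) hp.le).trans ?_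
  simp only [ENNReal.mul_rpow_of_nonneg D _ hp.le]
  rw [ENNReal.tsum_mul_left]
  exact mul_le_mul_right (tsum_rpow_decay_le ε hp _) _

lemma varNorm_indicator_top (hq : ∀ x, 0 < q x) {E : Set (Euc n)} (hE : MeasurableSet E)
    (hE0 : volume E ≠ 0) : varNorm q (E.indicator fun _ => ∞) = ∞ := by
  by_contra h
  obtain ⟨lam, -, -, h1, hmod⟩ := exists_of_varNorm_lt (lt_top_iff_ne_top.2 h)
  have hpt : ∀ x, (E.indicator (fun _ => (∞ : ℝ≥0∞)) x / lam) ^ q x =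
      E.indicator (fun _ => ∞) x := by
    intro x
    by_cases hx : x ∈ E
    · simp only [indicator_of_mem hx]
      rw [ENNReal.top_div_of_ne_top h1, ENNReal.top_rpow_of_pos (hq x)]
    · simp [hx, ENNReal.zero_rpow_of_pos (hq x)]
  simp only [hpt, lintegral_indicator hE, lintegral_const, Measure.restrict_apply_univ,
    ENNReal.top_mul hE0] at hmod
  exact absurd hmod (by simp)

lemma exists_maximalFn_ne_top (hn : 0 < n) (hp : 0 < p) (hq : ∀ x, 0 < q x)
    (h : herzNorm (varNorm q) α p (maximalFn f) ≠ ∞) : ∃ x, maximalFn f x ≠ ∞ := by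
  by_contra! hcon
  have hf : maximalFn f = fun _ => ∞ := funext hcon
  refine h ?_
  rw [herzNorm, ENNReal.rpow_eq_top_iff_of_pos (by positivity), ← top_le_iff]
  refine le_trans ?_ (ENNReal.le_tsum 0)
  rw [hf, varNorm_indicator_top hq (measurableSet_annulus 0) (volume_annulus_ne_zero hn 0),
    ENNReal.top_rpow_of_pos hp, ENNReal.mul_top (two_rpow_ne_zero _)]

lemma setLIntegral_ball_lt_top_of_maximalFn_ne_top {x₀ : Euc n} (h : maximalFn f x₀ ≠ ∞)
    (x : Euc n) (r : ℝ) : ∫⁻ y in Metric.ball x r, f y < ∞ := by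
  set R := max r (dist x₀ x + 1) with hR
  have hR0 : 0 < R := lt_max_of_lt_right (by positivity)
  have hx₀ : x₀ ∈ Metric.ball x R := Metric.mem_ball.2 (lt_max_of_lt_right (lt_add_one _))
  have havg := (average_le_maximalFn f hR0 hx₀).trans_lt h.lt_top
  refine (lintegral_mono_set (Metric.ball_subset_ball (le_max_left r (dist x₀ x + 1)))).trans_lt
    (lt_top_iff_ne_top.2 fun htop => havg.ne ?_)
  rw [hR, htop, ENNReal.mul_top (ENNReal.inv_ne_zero.2 (volume_ball_ne_top _ _))]

end

/-- Let `q(·) : ℝⁿ → (0,∞)` be globally log-Hölder continuous with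
`1 < q₋ ≤ q₊ < ∞`, and let `δ_{q(·)}, δ_{q'(·)} ∈ (0,1)` satisfy the dyadic estimates for
`L^{q(·)}` and `L^{q'(·)}`. If `−nδ_{q(·)} < α < nδ_{q'(·)}`, then the Hardy–Littlewood
maximal operator is bounded on the variable-exponent Herz space `K̇^{α,p}_{q(·)}(ℝⁿ)`. -/
theorem stmt13 {n : ℕ} (hn : 0 < n) (α p : ℝ) (hp : 0 < p)
    (q q' : Euc n → ℝ) (hqmeas : Measurable q)
    (qm qp : ℝ) (hqm : 1 < qm) (hbounds : ∀ᵐ x ∂(volume : Measure (Euc n)), qm ≤ q x ∧ q x ≤ qp)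
    (hlog : LogHolder q)
    (hq' : ∀ᵐ x ∂(volume : Measure (Euc n)), 1 / q x + 1 / q' x = 1)
    (δ₁ δ₂ : ℝ) (hδ₁ : 0 < δ₁ ∧ δ₁ < 1) (hδ₂ : 0 < δ₂ ∧ δ₂ < 1)
    (C : ℝ≥0∞) (hC : 0 < C ∧ C < ∞)
    (hdy₁ : ∀ (x : Euc n) (r : ℝ), 0 < r → ∀ E : Set (Euc n), MeasurableSet E →
      E ⊆ Metric.ball x r →
        varNorm q (E.indicator 1) / varNorm q ((Metric.ball x r).indicator 1)
          ≤ C * (volume E / volume (Metric.ball x r)) ^ δ₁)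
    (hdy₂ : ∀ (x : Euc n) (r : ℝ), 0 < r → ∀ E : Set (Euc n), MeasurableSet E →
      E ⊆ Metric.ball x r →
        varNorm q' (E.indicator 1) / varNorm q' ((Metric.ball x r).indicator 1)
          ≤ C * (volume E / volume (Metric.ball x r)) ^ δ₂)
    (hα : -((n : ℝ) * δ₁) < α ∧ α < (n : ℝ) * δ₂) :
    ∃ C' : ℝ≥0∞, 0 < C' ∧ C' < ∞ ∧
      ∀ f : Euc n → ℝ≥0∞, Measurable f → herzNorm (varNorm q) α p f ≠ ∞ →
        (∀ (x : Euc n) (r : ℝ), 0 < r → ∫⁻ y in Metric.ball x r, f y ∂volume < ∞) ∧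
        herzNorm (varNorm q) α p (maximalFn f) ≤ C' * herzNorm (varNorm q) α p f := by
  obtain ⟨L, hL, qinf, hloc, hinf⟩ := hlog
  have hq := bounds_of_ae_bounds (continuous_of_logHolder hL.le hloc) hbounds
  have hq1 : ∀ x, 1 < q x := fun x => hqm.trans_le (hq x).1
  have hconj : ∀ x, (q x).HolderConjugate ((q x).conjExponent) := fun x =>
    Real.HolderConjugate.conjExponent (hq1 x)
  have hq'meas : Measurable fun x => (q x).conjExponent := hqmeas.div (hqmeas.sub_const 1)
  have hq'eq : q' =ᵐ[volume] fun x => (q x).conjExponent := by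
    filter_upwards [hq'] with x hx
    have h := (hconj x).inv_add_inv_eq_one
    rw [one_div, one_div, ← h] at hx
    exact inv_inj.1 (add_left_cancel hx)
  have hq'le : ∀ x, (q x).conjExponent ≤ qm / (qm - 1) := by
    intro x
    have h1 : 0 < qm - 1 := sub_pos.2 hqm
    have h2 : 0 < q x - 1 := sub_pos.2 (hq1 x)
    rw [Real.conjExponent, div_le_div_iff₀ h2 h1]
    nlinarith [(hq x).1]
  obtain ⟨K, -, hK, hM⟩ := exists_varNorm_maximalFn_le hn hqm hq hqmeas ⟨L, hL, qinf, hloc, hinf⟩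
  simp only [varNorm_congr_exponent hq'eq] at hdy₂
  set K' : ℝ≥0∞ := 2 ^ (qm / (qm - 1)) * K with hK'
  have hK'top : K' ≠ ∞ := ENNReal.mul_ne_top (two_rpow_ne_top _) hK
  set ε := min (α + n * δ₁) (n * δ₂ - α) with hε
  have hε0 : 0 < ε := lt_min (by linarith [hα.1]) (by linarith [hα.2])
  set D : ℝ≥0∞ := 64 * (3 * (K * 2 ^ (|α| + ε)) + 8 ^ n * (2 * C * K')) *
    (decaySum (ε / 2) ^ p * decaySum (ε / 2 * p)) ^ (1 / p) with hD
  have hDtop : D ≠ ∞ := by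
    refine ENNReal.mul_ne_top (ENNReal.mul_ne_top (by simp) (ENNReal.add_ne_top.2 ⟨?_, ?_⟩)) ?_
    · exact ENNReal.mul_ne_top (by simp) (ENNReal.mul_ne_top hK (two_rpow_ne_top _))
    · exact ENNReal.mul_ne_top (ENNReal.pow_ne_top (by simp))
        (ENNReal.mul_ne_top (ENNReal.mul_ne_top (by simp) hC.2.ne) hK'top)
    · exact ENNReal.rpow_ne_top_of_nonneg (by positivity) (ENNReal.mul_ne_top
        (ENNReal.rpow_ne_top_of_nonneg hp.le (decaySum_ne_top (by positivity)))
        (decaySum_ne_top (by positivity)))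
  have hbound : ∀ f : Euc n → ℝ≥0∞, Measurable f →
      herzNorm (varNorm q) α p (maximalFn f) ≤ D * herzNorm (varNorm q) α p f := fun f hf =>
    herzNorm_le_of_decay hp fun k => varNorm_annulus_maximalFn_le hn hqmeas hconj hM hdy₁ hdy₂
      (fun c r hr => varNorm_ball_mul_varNorm_ball_le hconj hq'meas hq'le hM c hr)
      hε0 (min_le_left _ _) (min_le_right _ _) hf k
  refine ⟨D + 1, by simp, ENNReal.add_lt_top.2 ⟨hDtop.lt_top, one_lt_top⟩, fun f hf hfin => ?_⟩
  have hle := hbound f hf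
  refine ⟨fun x r _ => ?_, hle.trans (mul_le_mul_left le_self_add _)⟩
  obtain ⟨x₀, hx₀⟩ := exists_maximalFn_ne_top hn hp (fun x => one_pos.trans (hq1 x))
    (hle.trans_lt (ENNReal.mul_lt_top hDtop.lt_top hfin.lt_top)).ne
  exact setLIntegral_ball_lt_top_of_maximalFn_ne_top hx₀ x r
end
end
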